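/- arXiv:1312.7426 — 4 statements merged into one kernel-verified Lean document; each statement's English description precedes it below -/
import Mathlib

section
/- Let D be a dendrite and f : D → D a continuous transitive map. If End(D) is dense in D, then the set {x ∈ End(D) : the orbit of x under f is dense in D} is residual in D (in particular, it is dense in D). -/
open Set Topology Filter TopologicalSpace

/-- A dendrite: a nondegenerate continuum in which any two distinct points can be
separated by a third point. -/
def IsDendrite (X : Type*) [TopologicalSpace X] : Prop :=
  Nontrivial X ∧ ∀ x y : X, x ≠ y → ∃ z : X, z ≠ x ∧ z ≠ y ∧
    connectedComponentIn ({z}ᶜ : Set X) x ≠ connectedComponentIn ({z}ᶜ : Set X) y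

/-- `p` is an endpoint of `X` if `X \ {p}` is connected. -/
def IsEndpointOf (X : Type*) [TopologicalSpace X] (p : X) : Prop :=
  IsPreconnected ({p}ᶜ : Set X)

/-- A periodic point of `f`. -/
def IsPeriodic {X : Type*} (f : X → X) (x : X) : Prop :=
  ∃ n : ℕ, 1 ≤ n ∧ f^[n] x = x

/-- `x` has dense forward orbit under `f`. -/
def HasDenseOrbit {X : Type*} [TopologicalSpace X] (f : X → X) (x : X) : Prop :=
  Dense {y : X | ∃ n : ℕ, 1 ≤ n ∧ f^[n] x = y}

/-- Topological transitivity. -/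
def TopTransitive {X : Type*} [TopologicalSpace X] (f : X → X) : Prop :=
  ∀ U V : Set X, IsOpen U → IsOpen V → U.Nonempty → V.Nonempty →
    ∃ n : ℕ, 0 < n ∧ (f^[n] '' U ∩ V).Nonempty

/-- Total transitivity: every iterate is transitive. -/
def TotallyTransitive {X : Type*} [TopologicalSpace X] (f : X → X) : Prop :=
  ∀ n : ℕ, 1 ≤ n → TopTransitive (f^[n])

/-- Weak mixing: `f × f` is transitive. -/
def WeaklyMixing {X : Type*} [TopologicalSpace X] (f : X → X) : Prop :=
  TopTransitive (Prod.map f f)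

/-- Topological mixing. -/
def TopMixing {X : Type*} [TopologicalSpace X] (f : X → X) : Prop :=
  ∀ U V : Set X, IsOpen U → IsOpen V → U.Nonempty → V.Nonempty →
    ∃ N : ℕ, ∀ n, N ≤ n → (f^[n] '' U ∩ V).Nonempty

/-- Exactness. -/
def TopExact {X : Type*} [TopologicalSpace X] (f : X → X) : Prop :=
  ∀ U : Set X, IsOpen U → U.Nonempty → ∃ N : ℕ, 0 < N ∧ f^[N] '' U = Set.univ

/-- `A` is an arc with endpoints `a` and `b`. -/
def IsArcEnds {X : Type*} [TopologicalSpace X] (A : Set X) (a b : X) : Prop :=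
  ∃ e : (Set.Icc (0:ℝ) 1) ≃ₜ A,
    (e ⟨0, by norm_num⟩ : X) = a ∧ (e ⟨1, by norm_num⟩ : X) = b

/-- `A` is a free arc with endpoints `a` and `b`. -/
def IsFreeArc {X : Type*} [TopologicalSpace X] (A : Set X) (a b : X) : Prop :=
  IsArcEnds A a b ∧ IsOpen (A \ {a, b})

/-- A regular periodic decomposition of length `m` for `f`. -/
def IsRegPerDecomp {X : Type*} [TopologicalSpace X] (f : X → X) (m : ℕ)
    (Ds : ZMod m → Set X) : Prop :=
  0 < m ∧ (∀ i, Ds i = closure (interior (Ds i))) ∧ (⋃ i, Ds i) = Set.univ ∧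
    (∀ i, f '' Ds i = Ds (i + 1)) ∧ (∀ i j, i ≠ j → IsNowhereDense (Ds i ∩ Ds j))

/-- `f` admits a terminal (maximal-length) regular periodic decomposition. -/
def HasTerminalDecomp {X : Type*} [TopologicalSpace X] (f : X → X) : Prop :=
  ∃ (m : ℕ) (Ds : ZMod m → Set X), IsRegPerDecomp f m Ds ∧
    ∀ (m' : ℕ) (Ds' : ZMod m' → Set X), IsRegPerDecomp f m' Ds' → m' ≤ m

/-- The induced map on the hyperspace of nonempty closed (= compact) subsets. -/
def hyperMap {X : Type*} [TopologicalSpace X] {f : X → X} (hf : Continuous f) :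
    NonemptyCompacts X → NonemptyCompacts X :=
  fun A => ⟨⟨f '' A, A.isCompact.image hf⟩, A.nonempty.image f⟩

/-- The set of connected components of `X \ {p}`. -/
def componentsAt (X : Type*) [TopologicalSpace X] (p : X) : Set (Set X) :=
  {C | ∃ x : X, x ≠ p ∧ C = connectedComponentIn ({p}ᶜ : Set X) x}

section

variable {X : Type*} [TopologicalSpace X]

/-- The points separating `p` from `q`. -/
def separators (p q : X) : Set X :=
  {z | z ≠ p ∧ z ≠ q ∧
    connectedComponentIn ({z}ᶜ : Set X) p ≠ connectedComponentIn ({z}ᶜ : Set X) q}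

theorem IsDendrite.separators_nonempty (hX : IsDendrite X) {x y : X} (h : x ≠ y) :
    (separators x y).Nonempty :=
  hX.2 x y h

/-- A neighbourhood of a component of a compact Hausdorff space contains a clopen set containing
that component. -/
theorem exists_isClopen_subset_of_connectedComponent_subset [T2Space X] [CompactSpace X]
    {x : X} {U : Set X} (hU : IsOpen U) (h : connectedComponent x ⊆ U) :
    ∃ F : Set X, IsClopen F ∧ x ∈ F ∧ F ⊆ U := by
  have : Nonempty {s : Set X // IsClopen s ∧ x ∈ s} := ⟨⟨univ, isClopen_univ, mem_univ x⟩⟩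
  obtain ⟨⟨F, hF, hxF⟩, hFU⟩ := exists_subset_nhds_of_compactSpace
    (V := fun s : {s : Set X // IsClopen s ∧ x ∈ s} => (s : Set X))
    (fun s t => ⟨⟨s.1 ∩ t.1, s.2.1.inter t.2.1, s.2.2, t.2.2⟩,
      inter_subset_left, inter_subset_right⟩)
    (fun s => s.2.1.1)
    (fun y hy => hU.mem_nhds (h (by rwa [connectedComponent_eq_iInter_isClopen])))
  exact ⟨F, hF, hxF, hFU⟩

/-- Boundary bumping: in a continuum, the components of the complement of a point accumulate
at that point. -/
theorem mem_closure_connectedComponentIn_compl_singleton [T2Space X] [CompactSpace X]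
    [ConnectedSpace X] {x z : X} (hxz : x ≠ z) :
    z ∈ closure (connectedComponentIn ({z}ᶜ : Set X) x) := by
  by_contra hz
  set C := connectedComponentIn ({z}ᶜ : Set X) x
  have hxC : x ∈ C := mem_connectedComponentIn hxz
  have hcl : closure C ⊆ C :=
    isPreconnected_connectedComponentIn.closure.subset_connectedComponentIn (subset_closure hxC)
      (subset_compl_singleton_iff.2 hz)
  obtain ⟨V, hVo, hCV, hVz⟩ := normal_exists_closure_subset isClosed_closure
    isOpen_compl_singleton (subset_compl_singleton_iff.2 hz)
  have hxV : x ∈ V := hCV (subset_closure hxC)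
  have : CompactSpace (closure V) := isCompact_iff_compactSpace.1 isClosed_closure.isCompact
  have hsub : connectedComponent (⟨x, subset_closure hxV⟩ : closure V) ⊆ (↑) ⁻¹' V := by
    rw [← image_subset_iff]
    refine Subset.trans ?_ (subset_closure.trans hCV)
    refine (isPreconnected_connectedComponent.image _
      continuous_subtype_val.continuousOn).subset_connectedComponentIn
      ⟨_, mem_connectedComponent, rfl⟩ ?_
    rintro _ ⟨y, -, rfl⟩
    exact hVz y.2
  obtain ⟨F, hF, hxF, hFV⟩ := exists_isClopen_subset_of_connectedComponent_subset
    (hVo.preimage continuous_subtype_val) hsub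
  have hclosed : IsClosed ((↑) '' F : Set X) :=
    isClosed_closure.isClosedEmbedding_subtypeVal.isClosedMap _ hF.1
  have hopen : IsOpen ((↑) '' F : Set X) := by
    obtain ⟨W, hW, rfl⟩ := isOpen_induced_iff.1 hF.2
    convert hW.inter hVo using 1
    ext y
    constructor
    · rintro ⟨y, hy, rfl⟩
      exact ⟨hy, hFV hy⟩
    · rintro ⟨hyW, hyV⟩
      exact ⟨⟨y, subset_closure hyV⟩, hyW, rfl⟩
  have huniv := IsClopen.eq_univ ⟨hclosed, hopen⟩ ⟨x, _, hxF, rfl⟩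
  obtain ⟨y, -, hy⟩ : z ∈ ((↑) '' F : Set X) := huniv ▸ mem_univ z
  exact hVz y.2 hy

theorem isPreconnected_insert_connectedComponentIn_compl_singleton [T2Space X] [CompactSpace X]
    [ConnectedSpace X] {x z : X} (hxz : x ≠ z) :
    IsPreconnected (insert z (connectedComponentIn ({z}ᶜ : Set X) x)) :=
  isPreconnected_connectedComponentIn.subset_closure (subset_insert _ _)
    (insert_subset (mem_closure_connectedComponentIn_compl_singleton hxz) subset_closure)

theorem isPreconnected_compl_connectedComponentIn_compl_singleton [T2Space X] [CompactSpace X]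
    [ConnectedSpace X] (x z : X) :
    IsPreconnected (connectedComponentIn ({z}ᶜ : Set X) x)ᶜ := by
  have hz : ∀ y, z ∉ connectedComponentIn ({z}ᶜ : Set X) y := fun y h =>
    connectedComponentIn_subset _ _ h rfl
  refine isPreconnected_of_forall z fun y hy => ?_
  rcases eq_or_ne y z with rfl | hyz
  · exact ⟨{y}, by simpa using hy, rfl, rfl, isPreconnected_singleton⟩
  refine ⟨_, insert_subset (hz x) fun w hw hw' => hy ?_, mem_insert _ _,
    mem_insert_of_mem _ (mem_connectedComponentIn hyz),
    isPreconnected_insert_connectedComponentIn_compl_singleton hyz⟩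
  rw [connectedComponentIn_eq hw', ← connectedComponentIn_eq hw]
  exact mem_connectedComponentIn hyz

theorem notMem_separators_of_isPreconnected {K : Set X} (hK : IsPreconnected K) {p q z : X}
    (hp : p ∈ K) (hq : q ∈ K) (hz : z ∉ K) : z ∉ separators p q := fun h =>
  h.2.2 (connectedComponentIn_eq
    (hK.subset_connectedComponentIn hp (subset_compl_singleton_iff.2 hz) hq))

theorem IsDendrite.isOpen_connectedComponentIn_compl_singleton [T2Space X] [CompactSpace X]
    [ConnectedSpace X] (hX : IsDendrite X) (x z : X) :
    IsOpen (connectedComponentIn ({z}ᶜ : Set X) x) := by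
  rw [isOpen_iff_mem_nhds]
  intro y hy
  have hyz : y ≠ z := connectedComponentIn_subset _ _ hy
  rw [connectedComponentIn_eq hy]
  set C := connectedComponentIn ({z}ᶜ : Set X) y
  obtain ⟨w, hw⟩ := hX.separators_nonempty hyz
  have hwC : w ∈ C := by
    by_contra hwC
    exact notMem_separators_of_isPreconnected
      (isPreconnected_insert_connectedComponentIn_compl_singleton hyz)
      (mem_insert_of_mem _ (mem_connectedComponentIn hyz)) (mem_insert _ _)
      (by simp [hw.2.1, C, hwC]) hw
  have hzC : z ∈ Cᶜ := fun h => connectedComponentIn_subset _ _ h rfl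
  rw [← mem_interior_iff_mem_nhds, ← compl_compl C, interior_compl]
  intro hcl
  refine notMem_separators_of_isPreconnected (K := insert y Cᶜ)
    ((isPreconnected_compl_connectedComponentIn_compl_singleton y z).subset_closure
      (subset_insert _ _) (insert_subset hcl subset_closure))
    (mem_insert _ _) (mem_insert_of_mem _ hzC) ?_ hw
  simp [hw.1, hwC]

/-- In a dendrite, two distinct points have disjoint neighbourhoods the first of which may be
chosen closed and connected. -/
theorem IsDendrite.exists_isClosed_isPreconnected_mem_nhds [T2Space X] [CompactSpace X]
    [ConnectedSpace X] (hX : IsDendrite X) {c z : X} (h : c ≠ z) :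
    ∃ K ∈ 𝓝 c, IsClosed K ∧ IsPreconnected K ∧ z ∉ K := by
  obtain ⟨w, hwc, hwz, hw⟩ := hX.separators_nonempty h
  refine ⟨(connectedComponentIn {w}ᶜ z)ᶜ, mem_of_superset
    ((hX.isOpen_connectedComponentIn_compl_singleton c w).mem_nhds
      (mem_connectedComponentIn hwc.symm)) fun y hy hy' =>
        hw ((connectedComponentIn_eq hy).trans (connectedComponentIn_eq hy').symm),
    (hX.isOpen_connectedComponentIn_compl_singleton z w).isClosed_compl,
    isPreconnected_compl_connectedComponentIn_compl_singleton z w,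
    fun h => h (mem_connectedComponentIn hwz.symm)⟩

theorem IsDendrite.exists_isClosed_isPreconnected_of_mem_connectedComponentIn [T2Space X]
    [CompactSpace X] [ConnectedSpace X] (hX : IsDendrite X) {p q z : X}
    (h : q ∈ connectedComponentIn ({z}ᶜ : Set X) p) :
    ∃ K : Set X, IsClosed K ∧ IsPreconnected K ∧ z ∉ K ∧ p ∈ K ∧ q ∈ K := by
  have hp : p ∈ ({z}ᶜ : Set X) := connectedComponentIn_nonempty_iff.1 ⟨q, h⟩
  refine isPreconnected_connectedComponentIn.induction₂
    (fun p q => ∃ K : Set X, IsClosed K ∧ IsPreconnected K ∧ z ∉ K ∧ p ∈ K ∧ q ∈ K)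
    (fun c hc => ?_) ?_ ?_ (mem_connectedComponentIn hp) h
  · obtain ⟨K, hKc, hK, hK', hzK⟩ := hX.exists_isClosed_isPreconnected_mem_nhds
      (show c ≠ z from connectedComponentIn_subset _ _ hc)
    filter_upwards [mem_nhdsWithin_of_mem_nhds hKc] with d hd
    exact ⟨K, hK, hK', hzK, mem_of_mem_nhds hKc, hd⟩
  · rintro a b c - - - ⟨K, hK, hK', hzK, haK, hbK⟩ ⟨L, hL, hL', hzL, hbL, hcL⟩
    exact ⟨K ∪ L, hK.union hL, hK'.union b hbK hbL hL', by simp [hzK, hzL], .inl haK, .inr hcL⟩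
  · rintro a b - - ⟨K, hK, hK', hzK, haK, hbK⟩
    exact ⟨K, hK, hK', hzK, hbK, haK⟩

theorem IsDendrite.closure_separators_subset [T2Space X] [CompactSpace X] [ConnectedSpace X]
    (hX : IsDendrite X) (p q : X) : closure (separators p q) ⊆ separators p q ∪ {p, q} := by
  intro z hz
  by_contra hn
  simp only [mem_union, mem_insert_iff, mem_singleton_iff, not_or] at hn
  obtain ⟨hzS, hzp, hzq⟩ := hn
  have heq : connectedComponentIn ({z}ᶜ : Set X) p = connectedComponentIn ({z}ᶜ : Set X) q := by
    by_contra hne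
    exact hzS ⟨hzp, hzq, hne⟩
  have hq : q ∈ connectedComponentIn ({z}ᶜ : Set X) p :=
    heq ▸ mem_connectedComponentIn (Ne.symm hzq)
  obtain ⟨K, hK, hK', hzK, hpK, hqK⟩ :=
    hX.exists_isClosed_isPreconnected_of_mem_connectedComponentIn hq
  obtain ⟨v, hv, hvS⟩ := mem_closure_iff.1 hz _ hK.isOpen_compl hzK
  exact notMem_separators_of_isPreconnected hK' hpK hqK hv hvS

theorem notMem_separators_of_isEndpointOf {p q z : X} (hz : IsEndpointOf X z) :
    z ∉ separators p q := fun h =>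
  notMem_separators_of_isPreconnected hz h.1.symm h.2.1.symm (by simp) h

theorem IsDendrite.isNowhereDense_separators [T2Space X] [CompactSpace X] [ConnectedSpace X]
    (hX : IsDendrite X) (hdense : Dense {p : X | IsEndpointOf X p}) (p q : X) :
    IsNowhereDense (separators p q) := by
  have := hX.1
  rw [IsNowhereDense, ← not_nonempty_iff_eq_empty]
  intro hne
  obtain ⟨e, heI, he, hepq⟩ :=
    (hdense.sdiff_finite (toFinite {p, q})).inter_open_nonempty _ isOpen_interior hne
  exact (hX.closure_separators_subset p q (interior_subset heI)).elim
    (notMem_separators_of_isEndpointOf he) hepq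

theorem IsDendrite.exists_mem_separators [T2Space X] [CompactSpace X] [ConnectedSpace X]
    (hX : IsDendrite X) {Q : Set X} (hQ : Dense Q) {z : X} (hz : ¬ IsEndpointOf X z) :
    ∃ p ∈ Q, ∃ q ∈ Q, z ∈ separators p q := by
  obtain ⟨x, hx, y, hy, hne⟩ : ∃ x ∈ ({z}ᶜ : Set X), ∃ y ∈ ({z}ᶜ : Set X),
      connectedComponentIn ({z}ᶜ : Set X) x ≠ connectedComponentIn ({z}ᶜ : Set X) y := by
    by_contra! h
    refine hz (isPreconnected_of_forall_pair fun x hx y hy =>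
      ⟨_, connectedComponentIn_subset _ _, mem_connectedComponentIn hx, ?_,
        isPreconnected_connectedComponentIn⟩)
    rw [h x hx y hy]
    exact mem_connectedComponentIn hy
  obtain ⟨p, hp, hpQ⟩ := hQ.inter_open_nonempty _
    (hX.isOpen_connectedComponentIn_compl_singleton x z) ⟨x, mem_connectedComponentIn hx⟩
  obtain ⟨q, hq, hqQ⟩ := hQ.inter_open_nonempty _
    (hX.isOpen_connectedComponentIn_compl_singleton y z) ⟨y, mem_connectedComponentIn hy⟩
  refine ⟨p, hpQ, q, hqQ, Ne.symm (connectedComponentIn_subset _ _ hp),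
    Ne.symm (connectedComponentIn_subset _ _ hq), ?_⟩
  rwa [← connectedComponentIn_eq hp, ← connectedComponentIn_eq hq]

theorem IsDendrite.residual_isEndpointOf [T2Space X] [CompactSpace X] [ConnectedSpace X]
    [SeparableSpace X] (hX : IsDendrite X) (hdense : Dense {p : X | IsEndpointOf X p}) :
    {p : X | IsEndpointOf X p} ∈ residual X := by
  obtain ⟨Q, hQc, hQ⟩ := exists_countable_dense X
  have hM : IsMeagre (⋃ p ∈ Q, ⋃ q ∈ Q, separators p q) :=
    isMeagre_biUnion hQc fun p _ => isMeagre_biUnion hQc fun q _ =>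
      (hX.isNowhereDense_separators hdense p q).isMeagre
  refine mem_of_superset hM fun z hz => ?_
  by_contra hn
  obtain ⟨p, hp, q, hq, h⟩ := hX.exists_mem_separators hQ hn
  exact hz (mem_biUnion hp (mem_biUnion hq h))

theorem TopTransitive.residual_hasDenseOrbit [SecondCountableTopology X] {f : X → X}
    (hf : Continuous f) (h : TopTransitive f) : {x : X | HasDenseOrbit f x} ∈ residual X := by
  have hres : ∀ U ∈ countableBasis X, {x | ∃ n : ℕ, 1 ≤ n ∧ f^[n] x ∈ U} ∈ residual X := by
    intro U hU
    have hUo := isOpen_of_mem_countableBasis hU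
    refine residual_of_dense_open ?_ (dense_iff_inter_open.2 fun V hV hVne => ?_)
    · simp only [ofPred_exists, ofPred_and]
      exact isOpen_iUnion fun n => isOpen_const.inter (hUo.preimage (hf.iterate n))
    · obtain ⟨n, hn, _, ⟨x, hxV, rfl⟩, hxU⟩ :=
        h V U hV hUo hVne (nonempty_of_mem_countableBasis hU)
      exact ⟨x, hxV, n, hn, hxU⟩
  filter_upwards [(countable_bInter_mem (countable_countableBasis X)).2 hres] with x hx
  refine (isBasis_countableBasis X).dense_iff.2 fun U hU _ => ?_
  obtain ⟨n, hn, hxU⟩ := mem_iInter₂.1 hx U hU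
  exact ⟨_, hxU, n, hn, rfl⟩

end

/-- For a transitive map on a dendrite with dense endpoints, the endpoints
with dense orbit form a residual set. -/
theorem stmt1 {D : Type*} [MetricSpace D] [CompactSpace D] [ConnectedSpace D]
    (hD : IsDendrite D) {f : D → D} (hf : Continuous f) (htrans : TopTransitive f)
    (hdense : Dense {p : D | IsEndpointOf D p}) :
    {x : D | IsEndpointOf D x ∧ HasDenseOrbit f x} ∈ residual D := by
  exact inter_mem (hD.residual_isEndpointOf hdense) (htrans.residual_hasDenseOrbit hf)
end

section
/- Let D be a dendrite and f : D → D a continuous map. Let x, y ∈ D with x ≠ y, let [x,y] denote the unique arc in D from x to y and (x,y) = [x,y] \ {x,y}, and let U be the connected component of D \ {x,y} containing (x,y). If there exist m, n > 0 such that f^m(x) ∈ U and f^n(y) ∈ U, then U contains a periodic point of f. -/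
open Set Topology Filter TopologicalSpace

/-- The connected component of `q` in the complement of the point `p`; it is empty if `q = p`. -/
abbrev branchAt {X : Type*} [TopologicalSpace X] (p q : X) : Set X :=
  connectedComponentIn ({p}ᶜ : Set X) q

/-- The cut-point order of a space rooted at `a`: `p` precedes `q` when `p` equals `a` or `q`, or
separates `a` from `q`. -/
def CutLE {X : Type*} [TopologicalSpace X] (a p q : X) : Prop :=
  q ∉ branchAt p a

section Branch

variable {X : Type*} [TopologicalSpace X] {a p q r z : X}

theorem self_mem_branchAt (h : q ≠ p) : q ∈ branchAt p q :=
  mem_connectedComponentIn h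

theorem self_notMem_branchAt : p ∉ branchAt p q := fun h =>
  connectedComponentIn_subset _ _ h rfl

theorem branchAt_eq (h : q ∈ branchAt p a) : branchAt p a = branchAt p q :=
  connectedComponentIn_eq h

theorem ne_of_mem_branchAt (h : q ∈ branchAt p a) : a ≠ p :=
  connectedComponentIn_nonempty_iff.1 ⟨q, h⟩

theorem mem_branchAt_comm : q ∈ branchAt p a ↔ a ∈ branchAt p q := by
  constructor <;> intro h
  · exact branchAt_eq h ▸ self_mem_branchAt (ne_of_mem_branchAt h)
  · exact branchAt_eq h ▸ self_mem_branchAt (ne_of_mem_branchAt h)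

theorem mem_branchAt_trans (h₁ : q ∈ branchAt p a) (h₂ : r ∈ branchAt p q) : r ∈ branchAt p a :=
  branchAt_eq h₁ ▸ h₂

theorem isPreconnected_branchAt : IsPreconnected (branchAt p q) :=
  isPreconnected_connectedComponentIn

/-- A connected set avoiding `p` lies in a single branch at `p`. -/
theorem IsPreconnected.mem_branchAt {S : Set X} (hS : IsPreconnected S) (ha : a ∈ S) (hq : q ∈ S)
    (hp : p ∉ S) : q ∈ branchAt p a :=
  hS.subset_connectedComponentIn ha (subset_compl_singleton_iff.2 hp) hq

theorem cutLE_root : CutLE a a q := fun h => ne_of_mem_branchAt h rfl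

theorem cutLE_refl : CutLE a p p := self_notMem_branchAt

theorem CutLE.trans (h₁ : CutLE a p q) (h₂ : CutLE a q r) : CutLE a p r := by
  intro h
  have hap := ne_of_mem_branchAt h
  exact h₂ (isPreconnected_branchAt.mem_branchAt (self_mem_branchAt hap) h h₁)

/-- Boundary bumping for the complement of a point in a compact connected Hausdorff space. -/
theorem mem_closure_branchAt [CompactSpace X] [ConnectedSpace X] [T2Space X] (h : p ≠ z) :
    z ∈ closure (branchAt z p) := by
  by_contra hz
  set C := branchAt z p
  have hpC : p ∈ C := self_mem_branchAt h
  obtain ⟨V, hzV, hVo, hVC⟩ : ∃ V : Set X, z ∈ V ∧ IsOpen V ∧ Disjoint (closure V) C := by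
    obtain ⟨V, W, hV, hW, hzV, hCW, hVW⟩ := SeparatedNhds.of_isCompact_isCompact
      (isCompact_singleton (x := z)) (isClosed_closure (s := C)).isCompact
      (disjoint_singleton_left.2 hz)
    exact ⟨V, hzV rfl, hV, (hVW.closure_left hW).mono_right (subset_closure.trans hCW)⟩
  have hYc : IsClosed Vᶜ := hVo.isClosed_compl
  have : CompactSpace (Vᶜ : Set X) := isCompact_iff_compactSpace.1 hYc.isCompact
  have hpV : p ∈ Vᶜ := fun h' => hVC.le_bot ⟨subset_closure h', hpC⟩
  let p' : (Vᶜ : Set X) := ⟨p, hpV⟩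
  have hcomp : ∀ y : (Vᶜ : Set X), y ∈ connectedComponent p' → (y : X) ∈ C := by
    intro y hy
    refine IsPreconnected.mem_branchAt
      (isPreconnected_connectedComponent.image _ continuous_subtype_val.continuousOn)
      ⟨p', mem_connectedComponent, rfl⟩ ⟨y, hy, rfl⟩ ?_
    rintro ⟨t, -, rfl⟩
    exact t.2 hzV
  have hFc : IsClosed ((↑) ⁻¹' closure V : Set (Vᶜ : Set X)) :=
    isClosed_closure.preimage continuous_subtype_val
  obtain ⟨O, hO, hpO, hOV⟩ : ∃ O : Set (Vᶜ : Set X), IsClopen O ∧ p' ∈ O ∧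
      O ∩ ((↑) ⁻¹' closure V) = ∅ := by
    by_contra! hcon
    have : Nonempty { s : Set (Vᶜ : Set X) // IsClopen s ∧ p' ∈ s } :=
      ⟨⟨univ, isClopen_univ, mem_univ _⟩⟩
    have := IsCompact.nonempty_iInter_of_directed_nonempty_isCompact_isClosed
      (fun s : { s : Set (Vᶜ : Set X) // IsClopen s ∧ p' ∈ s } =>
        s.1 ∩ (((↑) : (Vᶜ : Set X) → X) ⁻¹' closure V))
      (fun s t => ⟨⟨s.1 ∩ t.1, s.2.1.inter t.2.1, s.2.2, t.2.2⟩,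
        fun _ hy => ⟨hy.1.1, hy.2⟩, fun _ hy => ⟨hy.1.2, hy.2⟩⟩)
      (fun s => hcon s.1 s.2.1 s.2.2)
      (fun s => (s.2.1.isClosed.inter hFc).isCompact)
      (fun s => s.2.1.isClosed.inter hFc)
    obtain ⟨y, hy⟩ := this
    rw [mem_iInter] at hy
    have hyc : y ∈ connectedComponent p' := by
      rw [connectedComponent_eq_iInter_isClopen, mem_iInter]
      exact fun s => (hy s).1
    exact hVC.le_bot ⟨(hy ⟨univ, isClopen_univ, mem_univ _⟩).2, hcomp y hyc⟩
  have hOcl : IsClosed ((↑) '' O : Set X) := hYc.isClosedEmbedding_subtypeVal.isClosedMap _ hO.1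
  have hOop : IsOpen ((↑) '' O : Set X) := by
    obtain ⟨O', hO', rfl⟩ := isOpen_induced_iff.1 hO.2
    have : ((↑) '' ((↑) ⁻¹' O' : Set (Vᶜ : Set X)) : Set X) = O' ∩ (closure V)ᶜ := by
      ext y
      constructor
      · rintro ⟨t, ht, rfl⟩
        exact ⟨ht, fun h' => (hOV.subset ⟨ht, h'⟩).elim⟩
      · rintro ⟨hy, hyV⟩
        exact ⟨⟨y, fun h' => hyV (subset_closure h')⟩, hy, rfl⟩
    rw [this]
    exact hO'.inter isClosed_closure.isOpen_compl
  rcases isClopen_iff.1 ⟨hOcl, hOop⟩ with h' | h'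
  · exact (h'.subset ⟨p', hpO, rfl⟩).elim
  · obtain ⟨t, -, ht⟩ := h'.symm.subset (mem_univ z)
    exact t.2 (ht ▸ hzV)

theorem isPreconnected_insert_branchAt [CompactSpace X] [ConnectedSpace X] [T2Space X] :
    IsPreconnected (insert p (branchAt p q)) := by
  rcases eq_or_ne q p with rfl | h
  · rw [branchAt, connectedComponentIn_eq_empty (by simp), insert_empty_eq]
    exact isPreconnected_singleton
  · exact isPreconnected_branchAt.subset_closure (subset_insert _ _)
      (insert_subset (mem_closure_branchAt h) subset_closure)

/-- The complement of a branch at `p` is connected. -/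
theorem isPreconnected_compl_branchAt [CompactSpace X] [ConnectedSpace X] [T2Space X] :
    IsPreconnected (branchAt p q)ᶜ := by
  have : (branchAt p q)ᶜ = ⋃₀ {S | ∃ r ∉ branchAt p q, S = insert p (branchAt p r)} := by
    ext r
    constructor
    · intro hr
      refine ⟨_, ⟨r, hr, rfl⟩, ?_⟩
      rcases eq_or_ne r p with rfl | h
      · exact mem_insert _ _
      · exact mem_insert_of_mem _ (self_mem_branchAt h)
    · rintro ⟨_, ⟨s, hs, rfl⟩, rfl | hr⟩
      · exact self_notMem_branchAt
      · exact fun h => hs (mem_branchAt_trans h (mem_branchAt_comm.1 hr))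
  rw [this]
  refine isPreconnected_sUnion p _ ?_ ?_
  · rintro _ ⟨r, -, rfl⟩
    exact mem_insert _ _
  · rintro _ ⟨r, -, rfl⟩
    exact isPreconnected_insert_branchAt

theorem cutLE_antisymm [CompactSpace X] [ConnectedSpace X] [T2Space X]
    (h₁ : CutLE a p q) (h₂ : CutLE a q p) : p = q := by
  by_contra hne
  have hap : a ≠ p := by
    rintro rfl
    exact h₂ (self_mem_branchAt hne)
  refine h₂ (isPreconnected_insert_branchAt.mem_branchAt (S := insert p (branchAt p a))
    (mem_insert_of_mem _ (self_mem_branchAt hap)) (mem_insert _ _) ?_)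
  rintro (h | h)
  exacts [hne h.symm, h₁ h]

/-- A point separating `p` from a successor `q` lies between them. -/
theorem cutLE_of_notMem_branchAt [CompactSpace X] [ConnectedSpace X] [T2Space X]
    (h : CutLE a p q) (hrp : r ≠ p) (hrq : r ≠ q) (hr : q ∉ branchAt r p) :
    CutLE a p r ∧ CutLE a r q := by
  have hqp : q ≠ p := by
    rintro rfl
    exact hr (self_mem_branchAt hrq.symm)
  constructor
  · have hrC : r ∈ branchAt p q := by
      by_contra hrC
      refine hr (isPreconnected_insert_branchAt.mem_branchAt (S := insert p (branchAt p q))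
        (mem_insert _ _) (mem_insert_of_mem _ (self_mem_branchAt hqp)) ?_)
      rintro (h' | h')
      exacts [hrp h', hrC h']
    exact fun h' => h (mem_branchAt_trans h' (mem_branchAt_comm.1 hrC))
  · intro h'
    exact h (isPreconnected_branchAt.mem_branchAt (self_mem_branchAt (ne_of_mem_branchAt h')) h'
      fun hp => hr (mem_branchAt_trans (mem_branchAt_comm.1 hp) h'))

theorem IsDendrite.exists_notMem_branchAt (hX : IsDendrite X) (h : p ≠ q) :
    ∃ r, r ≠ p ∧ r ≠ q ∧ q ∉ branchAt r p := by
  obtain ⟨r, h₁, h₂, h₃⟩ := hX.2 p q h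
  exact ⟨r, h₁, h₂, fun h' => h₃ (branchAt_eq h')⟩

end Branch

namespace IsDendrite

variable {D : Type*} [TopologicalSpace D] [CompactSpace D] [ConnectedSpace D] [T2Space D]
  {a p q r z : D}

theorem isOpen_branchAt (hD : IsDendrite D) : IsOpen (branchAt z p) := by
  rw [isOpen_iff_mem_nhds]
  intro c hc
  have hcz : c ≠ z := fun h => self_notMem_branchAt (h ▸ hc)
  rw [branchAt_eq hc]
  obtain ⟨s, hsc, hsz, hs⟩ := hD.exists_notMem_branchAt hcz
  have hsC : s ∈ branchAt z c := by
    by_contra hsC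
    refine hs (isPreconnected_insert_branchAt.mem_branchAt (S := insert z (branchAt z c))
      (mem_insert_of_mem _ (self_mem_branchAt hcz)) (mem_insert _ _) ?_)
    rintro (h | h)
    exacts [hsz h, hsC h]
  have hsub : (branchAt z c)ᶜ ⊆ branchAt s z := fun y hy =>
    isPreconnected_compl_branchAt.mem_branchAt self_notMem_branchAt hy (not_not.2 hsC)
  have hcl : c ∉ closure (branchAt s z) := by
    intro hcl
    refine hs (mem_branchAt_comm.1 ?_)
    refine (isPreconnected_branchAt.subset_closure (s := branchAt s z) (subset_insert c _)
      (insert_subset hcl subset_closure)).mem_branchAt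
      (mem_insert_of_mem _ (self_mem_branchAt hsz.symm)) (mem_insert _ _) ?_
    rintro (h | h)
    exacts [hsc h, self_notMem_branchAt h]
  refine mem_of_superset (isClosed_closure.isOpen_compl.mem_nhds hcl) fun y hy => ?_
  by_contra hyC
  exact hy (subset_closure (hsub hyC))

theorem exists_isClosed_isPreconnected_mem_nhds_s3 (hD : IsDendrite D) (h : q ≠ p) :
    ∃ M : Set D, IsClosed M ∧ IsPreconnected M ∧ M ∈ 𝓝 q ∧ p ∉ M := by
  obtain ⟨r, hrq, hrp, hr⟩ := hD.exists_notMem_branchAt h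
  refine ⟨(branchAt r p)ᶜ, hD.isOpen_branchAt.isClosed_compl, isPreconnected_compl_branchAt,
    mem_of_superset (hD.isOpen_branchAt.mem_nhds (self_mem_branchAt hrq.symm)) fun y hy hy' => ?_,
    not_not.2 (self_mem_branchAt hrp.symm)⟩
  exact hr (mem_branchAt_trans hy (mem_branchAt_comm.1 hy'))

/-- Two points of the same branch at `p` are joined by a continuum avoiding `p`. -/
theorem exists_isClosed_isPreconnected_of_mem_branchAt (hD : IsDendrite D)
    (h : q ∈ branchAt p a) :
    ∃ K : Set D, IsClosed K ∧ IsPreconnected K ∧ a ∈ K ∧ K ∈ 𝓝 q ∧ p ∉ K := by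
  let E : Set D := {q | ∃ K : Set D, IsClosed K ∧ IsPreconnected K ∧ a ∈ K ∧ K ∈ 𝓝 q ∧ p ∉ K}
  have key : ∀ q, q ≠ p → q ∈ closure E → q ∈ E := by
    intro q hqp hq
    obtain ⟨M, hMc, hMp, hMn, hM⟩ := hD.exists_isClosed_isPreconnected_mem_nhds_s3 hqp
    obtain ⟨e, heM, K, hKc, hKp, haK, hKn, hK⟩ := mem_closure_iff_nhds.1 hq M hMn
    refine ⟨K ∪ M, hKc.union hMc, hKp.union e (mem_of_mem_nhds hKn) heM hMp, Or.inl haK,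
      mem_of_superset hMn subset_union_right, ?_⟩
    rintro (h | h)
    exacts [hK h, hM h]
  have haE : a ∈ E := by
    obtain ⟨M, hMc, hMp, hMn, hM⟩ :=
      hD.exists_isClosed_isPreconnected_mem_nhds_s3 (ne_of_mem_branchAt h)
    exact ⟨M, hMc, hMp, mem_of_mem_nhds hMn, hMn, hM⟩
  have hEo : IsOpen E := by
    rw [isOpen_iff_mem_nhds]
    rintro q ⟨K, hKc, hKp, haK, hKn, hK⟩
    filter_upwards [eventually_mem_nhds_iff.2 hKn] with y hy
    exact ⟨K, hKc, hKp, haK, hy, hK⟩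
  exact isPreconnected_branchAt.subset_of_closure_inter_subset hEo
    ⟨a, self_mem_branchAt (ne_of_mem_branchAt h), haE⟩
    (fun y hy => key y (fun h' => self_notMem_branchAt (h' ▸ hy.2)) hy.1) h

theorem isClosed_setOf_cutLE (hD : IsDendrite D) (a : D) :
    IsClosed {x : D × D | CutLE a x.1 x.2} := by
  rw [← isOpen_compl_iff, isOpen_iff_mem_nhds]
  rintro ⟨p, q⟩ h
  obtain ⟨K, hKc, hKp, haK, hKn, hK⟩ :=
    hD.exists_isClosed_isPreconnected_of_mem_branchAt (not_not.1 h)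
  filter_upwards [prod_mem_nhds (hKc.isOpen_compl.mem_nhds hK) hKn] with y hy
  exact not_not.2 (hKp.mem_branchAt haK hy.2 hy.1)

end IsDendrite

/-- In a compact space, every nonempty closed set has a maximal element for any preorder whose
upper sets are closed. -/
theorem IsClosed.exists_maximal_of_isClosed_rel {X : Type*} [TopologicalSpace X] [CompactSpace X]
    {r : X → X → Prop} (hrefl : ∀ p, r p p) (htrans : ∀ {p q s}, r p q → r q s → r p s)
    (hr : ∀ p, IsClosed {q | r p q}) {T : Set X} (hT : IsClosed T) (hne : T.Nonempty) :
    ∃ m ∈ T, ∀ q ∈ T, r m q → r q m := by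
  have hchain : ∀ c : Set T, IsChain (fun p q : T => r p q) c → ∃ ub : T, ∀ p ∈ c, r p ub := by
    intro c hc
    rcases c.eq_empty_or_nonempty with rfl | ⟨p₀, hp₀⟩
    · exact ⟨⟨_, hne.some_mem⟩, by simp⟩
    · have : Nonempty c := ⟨⟨p₀, hp₀⟩⟩
      have hcl : ∀ p : c, IsClosed (T ∩ {q | r p q}) := fun p => hT.inter (hr _)
      have hdir : Directed (· ⊇ ·) fun p : c => T ∩ {q | r p q} := by
        intro p q
        rcases eq_or_ne p.1 q.1 with h | h
        · exact ⟨p, subset_rfl, fun y hy => ⟨hy.1, h ▸ hy.2⟩⟩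
        · rcases hc p.2 q.2 h with h | h
          · exact ⟨q, fun y hy => ⟨hy.1, htrans h hy.2⟩, subset_rfl⟩
          · exact ⟨p, subset_rfl, fun y hy => ⟨hy.1, htrans h hy.2⟩⟩
      obtain ⟨u, hu⟩ := IsCompact.nonempty_iInter_of_directed_nonempty_isCompact_isClosed _ hdir
        (fun p => ⟨p, p.1.2, hrefl _⟩) (fun p => (hcl p).isCompact) hcl
      rw [mem_iInter] at hu
      exact ⟨⟨u, (hu ⟨p₀, hp₀⟩).1⟩, fun p hp => (hu ⟨p, hp⟩).2⟩
  obtain ⟨⟨m, hm⟩, h⟩ := exists_maximal_of_chains_bounded hchain (fun h₁ h₂ => htrans h₁ h₂)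
  exact ⟨m, hm, fun q hq => h ⟨q, hq⟩⟩

namespace IsDendrite

variable {D : Type*} [TopologicalSpace D] [CompactSpace D] [ConnectedSpace D] [T2Space D]
  {a m s : D}

theorem isClosed_setOf_cutLE_right (hD : IsDendrite D) (p : D) : IsClosed {q | CutLE a p q} :=
  (hD.isClosed_setOf_cutLE a).preimage (Continuous.prodMk_right p)

theorem isClosed_setOf_cutLE_left (hD : IsDendrite D) (q : D) : IsClosed {p | CutLE a p q} :=
  (hD.isClosed_setOf_cutLE a).preimage (Continuous.prodMk_left q)

/-- A point has arbitrarily close strict successors below any given strict successor. -/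
theorem exists_cutLE_between_mem (hD : IsDendrite D) (hms : CutLE a m s) (hne : s ≠ m)
    {V : Set D} (hV : IsOpen V) (hmV : m ∈ V) :
    ∃ t ∈ V, t ≠ m ∧ CutLE a m t ∧ CutLE a t s := by
  by_contra! hcon
  have hsV : s ∉ V := fun h => hcon s h hne hms cutLE_refl
  obtain ⟨t, ⟨⟨hmt, hts⟩, htV⟩, htmin⟩ := IsClosed.exists_maximal_of_isClosed_rel
    (r := fun p q => CutLE a q p) (fun _ => cutLE_refl) (fun h₁ h₂ => h₂.trans h₁)
    hD.isClosed_setOf_cutLE_left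
    (((hD.isClosed_setOf_cutLE_right m).inter (hD.isClosed_setOf_cutLE_left s)).inter
      hV.isClosed_compl) ⟨s, ⟨hms, cutLE_refl⟩, hsV⟩
  have htm : m ≠ t := fun h => htV (h ▸ hmV)
  obtain ⟨r, hrm, hrt, hr⟩ := hD.exists_notMem_branchAt htm
  obtain ⟨h₁, h₂⟩ := cutLE_of_notMem_branchAt hmt hrm hrt hr
  have hrs := h₂.trans hts
  exact hrt (cutLE_antisymm h₂ (htmin r ⟨⟨h₁, hrs⟩, fun h => hcon r h hrm h₁ hrs⟩ h₂))

/-- The fixed point property of dendrites. -/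
theorem exists_fixedPoint (hD : IsDendrite D) {h : D → D} (hh : Continuous h) :
    ∃ p, h p = p := by
  obtain ⟨a, -⟩ := hD.1.exists_pair_ne
  have hP : IsClosed {p | CutLE a p (h p)} :=
    (hD.isClosed_setOf_cutLE a).preimage (continuous_id.prodMk hh)
  obtain ⟨m, hm, hmax⟩ := IsClosed.exists_maximal_of_isClosed_rel
    (r := CutLE a) (fun _ => cutLE_refl) (fun h₁ h₂ => h₁.trans h₂)
    hD.isClosed_setOf_cutLE_right hP ⟨a, cutLE_root⟩
  by_contra! hfix
  obtain ⟨s, hsm, hsh, hs⟩ := hD.exists_notMem_branchAt (hfix m).symm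
  obtain ⟨hms, hsh'⟩ := cutLE_of_notMem_branchAt hm hsm hsh hs
  obtain ⟨t, htV, htm, hmt, hts⟩ := hD.exists_cutLE_between_mem hms hsm
    (hD.isOpen_branchAt.preimage hh) (self_mem_branchAt hsh.symm : h m ∈ branchAt s (h m))
  refine htm (cutLE_antisymm (hmax t (hts.trans fun h' => ?_) hmt) hmt)
  exact hsh' (mem_branchAt_trans h' (mem_branchAt_comm.1 htV))

/-- Along an arc starting at the root, the cut-point order agrees with the parameter. -/
theorem cutLE_of_le (hD : IsDendrite D) {φ : unitInterval → D} (hφ : Continuous φ)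
    (hinj : Function.Injective φ) {u v : unitInterval} (huv : u ≤ v) :
    CutLE (φ 0) (φ u) (φ v) := by
  rcases huv.eq_or_lt with rfl | huv
  · exact cutLE_refl
  intro hmem
  obtain ⟨K, hKc, hKp, h0K, hvK, huK⟩ := hD.exists_isClosed_isPreconnected_of_mem_branchAt hmem
  replace hvK := mem_of_mem_nhds hvK
  obtain ⟨β, hβ, hβK⟩ : ∃ β ∈ Ioc u v, ∀ t ∈ Icc u β, φ t ∉ K := by
    have hn : φ ⁻¹' Kᶜ ∈ 𝓝 u := (hKc.isOpen_compl.preimage hφ).mem_nhds huK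
    obtain ⟨l, hl, hlK⟩ := exists_Ico_subset_of_mem_nhds hn ⟨v, huv⟩
    obtain ⟨β, hβ₁, hβ₂⟩ := exists_between (lt_min hl huv)
    exact ⟨β, ⟨hβ₁, (hβ₂.trans_le (min_le_right _ _)).le⟩, fun t ht =>
      hlK ⟨ht.1, ht.2.trans_lt (hβ₂.trans_le (min_le_left _ _))⟩⟩
  have him : ∀ b c, IsPreconnected (φ '' Icc b c) := fun b c =>
    isPreconnected_Icc.image _ hφ.continuousOn
  obtain ⟨r, hru, hrβ, hr⟩ := hD.exists_notMem_branchAt (hinj.ne hβ.1.ne)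
  obtain ⟨ρ, hρ, rfl⟩ : r ∈ φ '' Icc u β := by
    by_contra h
    exact hr ((him u β).mem_branchAt ⟨u, ⟨le_rfl, hβ.1.le⟩, rfl⟩ ⟨β, ⟨hβ.1.le, le_rfl⟩, rfl⟩ h)
  have hρu : u < ρ := hρ.1.lt_of_ne fun h => hru (h ▸ rfl)
  have hρβ : ρ < β := hρ.2.lt_of_ne fun h => hrβ (h ▸ rfl)
  have hS : IsPreconnected (φ '' Icc 0 u ∪ K ∪ φ '' Icc β v) :=
    IsPreconnected.union (φ v) (Or.inr hvK) (mem_image_of_mem φ (right_mem_Icc.2 hβ.2))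
      (IsPreconnected.union (φ 0) (mem_image_of_mem φ (left_mem_Icc.2 u.2.1)) h0K (him 0 u) hKp)
      (him β v)
  refine hr (hS.mem_branchAt (Or.inl (Or.inl ⟨u, ⟨u.2.1, le_rfl⟩, rfl⟩))
    (Or.inr ⟨β, ⟨le_rfl, hβ.2⟩, rfl⟩) ?_)
  rintro ((⟨t, ht, htρ⟩ | h) | ⟨t, ht, htρ⟩)
  · exact (ht.2.trans_lt hρu).ne (hinj htρ)
  · exact hβK ρ hρ h
  · exact (hρβ.trans_le ht.1).ne' (hinj htρ)

/-- A dendrite retracts onto any arc in it by a map which is locally constant off the arc. -/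
theorem exists_retraction (hD : IsDendrite D) {φ : unitInterval → D} (hφ : Continuous φ)
    (hinj : Function.Injective φ) :
    ∃ π : D → unitInterval, Continuous π ∧ (∀ u, π (φ u) = u) ∧
      ∀ u, IsOpen (π ⁻¹' {u} \ {φ u}) := by
  let π : D → unitInterval := fun d => sSup {u | CutLE (φ 0) (φ u) d}
  have hle : ∀ u d, u ≤ π d ↔ CutLE (φ 0) (φ u) d := by
    intro u d
    have hcl : IsClosed {u | CutLE (φ 0) (φ u) d} :=
      (hD.isClosed_setOf_cutLE_left d).preimage hφ
    have hmem : CutLE (φ 0) (φ (π d)) d := IsClosed.sSup_mem ⟨0, cutLE_root⟩ hcl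
    exact ⟨fun h => (hD.cutLE_of_le hφ hinj h).trans hmem, fun h => le_sSup h⟩
  have hπφ : ∀ u, π (φ u) = u := by
    intro u
    refine le_antisymm ?_ ((hle _ _).2 cutLE_refl)
    by_contra! h
    exact h.ne (hinj (cutLE_antisymm (hD.cutLE_of_le hφ hinj h.le) ((hle _ _).1 le_rfl)))
  have hbranch : ∀ {u d e}, d ≠ φ u → e ∈ branchAt (φ u) d → u ≤ π d → u ≤ π e := by
    intro u d e hd he h
    rw [hle] at h ⊢
    exact fun h' => h (mem_branchAt_trans h' (mem_branchAt_comm.1 he))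
  refine ⟨π, ?_, hπφ, fun u => ?_⟩
  · refine continuous_iff_lower_upperSemicontinuous.2 ⟨?_, ?_⟩
    · rw [lowerSemicontinuous_iff_isOpen_preimage]
      refine fun v => isOpen_iff_mem_nhds.2 fun d hd => ?_
      obtain ⟨v', hv, hv'⟩ := exists_between (show v < π d from hd)
      have hne : d ≠ φ v' := by
        rintro rfl
        exact hv'.ne (hπφ v').symm
      filter_upwards [hD.isOpen_branchAt.mem_nhds (self_mem_branchAt hne)] with e he
      exact hv.trans_le (hbranch hne he hv'.le)
    · rw [upperSemicontinuous_iff_isClosed_preimage]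
      intro v
      have : π ⁻¹' Ici v = {d | CutLE (φ 0) (φ v) d} := ext fun d => hle v d
      rw [this]
      exact hD.isClosed_setOf_cutLE_right _
  · rw [isOpen_iff_mem_nhds]
    rintro d ⟨hdu : π d = u, hd : d ≠ φ u⟩
    filter_upwards [hD.isOpen_branchAt.mem_nhds (self_mem_branchAt hd)] with e he
    refine ⟨le_antisymm ?_ (hbranch hd he hdu.ge), fun h : e = φ u =>
      self_notMem_branchAt (h ▸ he)⟩
    by_contra! hlt
    obtain ⟨K, hKc, hKp, hdK, heK, huK⟩ := hD.exists_isClosed_isPreconnected_of_mem_branchAt he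
    have hn : φ ⁻¹' Kᶜ ∈ 𝓝 u := (hKc.isOpen_compl.preimage hφ).mem_nhds huK
    obtain ⟨l, hl, hlK⟩ := exists_Ico_subset_of_mem_nhds hn ⟨_, hlt⟩
    obtain ⟨v, huv, hv⟩ := exists_between (lt_min hl hlt)
    have hvK : φ v ∉ K := hlK ⟨huv.le, hv.trans_le (min_le_left _ _)⟩
    have hve : CutLE (φ 0) (φ v) e := (hle _ _).1 (hv.trans_le (min_le_right _ _)).le
    have hvd : CutLE (φ 0) (φ v) d := fun h =>
      hve (mem_branchAt_trans h (hKp.mem_branchAt hdK (mem_of_mem_nhds heK) hvK))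
    exact (((hle _ _).2 hvd).trans hdu.le).not_gt huv

end IsDendrite

/-- If the fibre of `π` over `u` is open apart from the point `t`, then the space retracts onto
that fibre by collapsing its complement to `t`. -/
theorem exists_continuous_retraction_fiber {X Y : Type*} [TopologicalSpace X] [TopologicalSpace Y]
    [T1Space Y] {π : X → Y} (hπ : Continuous π) {u : Y} {t : X} (ht : π t = u)
    (hopen : IsOpen (π ⁻¹' {u} \ {t})) :
    ∃ q : X → X, Continuous q ∧ (∀ p, π (q p) = u) ∧ (∀ p, π p = u → q p = p) ∧
      ∀ p, π p ≠ u → q p = t := by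
  classical
  refine ⟨fun p => if π p = u then p else t, ?_, fun p => ?_, fun p hp => if_pos hp,
    fun p hp => if_neg hp⟩
  · rw [continuous_iff_isClosed]
    intro F hF
    have hfib : IsClosed (π ⁻¹' {u}) := isClosed_singleton.preimage hπ
    by_cases htF : t ∈ F
    · have : (fun p => if π p = u then p else t) ⁻¹' F = F ∪ (π ⁻¹' {u} \ {t})ᶜ := by
        ext p
        simp only [mem_preimage, mem_union, mem_compl_iff, Set.mem_sdiff, mem_singleton_iff]
        by_cases hp : π p = u
        · by_cases hpt : p = t <;> simp [hp, hpt, htF, ht]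
        · simp [hp, htF]
      rw [this]
      exact hF.union hopen.isClosed_compl
    · have : (fun p => if π p = u then p else t) ⁻¹' F = F ∩ π ⁻¹' {u} := by
        ext p
        by_cases hp : π p = u <;> simp [hp, htF]
      rw [this]
      exact hF.inter hfib
  · dsimp only
    split_ifs with hp
    exacts [hp, ht]

/-- A self-map has a fixed point in a fibre which is open apart from `t` whenever it maps `t` back
to that fibre. -/
theorem IsDendrite.exists_fixedPoint_mem_fiber {D Y : Type*} [TopologicalSpace D] [CompactSpace D]
    [ConnectedSpace D] [T2Space D] [TopologicalSpace Y] [T1Space Y] (hD : IsDendrite D)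
    {π : D → Y} (hπ : Continuous π) {u : Y} {t : D} (ht : π t = u)
    (hopen : IsOpen (π ⁻¹' {u} \ {t})) {h : D → D} (hh : Continuous h) (hht : π (h t) = u) :
    ∃ p, π p = u ∧ h p = p := by
  obtain ⟨q, hq, hqmem, hqid, hqt⟩ := exists_continuous_retraction_fiber hπ ht hopen
  obtain ⟨p, hp⟩ := hD.exists_fixedPoint (hq.comp hh)
  have hp' : q (h p) = p := hp
  refine ⟨p, hp ▸ hqmem _, ?_⟩
  have hhp : π (h p) = u := by
    by_contra hhp
    rw [hqt _ hhp] at hp'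
    exact hhp (hp' ▸ hht)
  rwa [hqid _ hhp] at hp'

/-- If `F` moves some point other than `1` upwards and has no fixed point in the open interval,
then it moves every point of the open interval upwards. -/
theorem unitInterval.lt_of_forall_ne {F : unitInterval → unitInterval} (hF : Continuous F)
    (hfix : ∀ s, 0 < s → s < 1 → F s ≠ s) {c s : unitInterval} (hc1 : c < 1) (hc : c < F c)
    (hs0 : 0 < s) (hs1 : s < 1) : s < F s := by
  by_contra! hs
  have hs' : F s < s := hs.lt_of_ne (hfix s hs0 hs1)
  obtain ⟨t, ht, hFt⟩ := isPreconnected_uIcc.intermediate_value₂ (right_mem_uIcc (a := c))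
    (left_mem_uIcc (b := s)) hF.continuousOn continuousOn_id hs hc.le
  have htc : t ≠ c := fun h => hc.ne' (h ▸ hFt)
  refine hfix t (lt_of_le_of_ne t.2.1 fun h0 => ?_) (lt_of_le_of_ne t.2.2 fun h1 => ?_) hFt
  · rcases le_total c s with hcs | hcs
    · rw [uIcc_of_le hcs] at ht
      exact htc (le_antisymm (h0 ▸ c.2.1) ht.1)
    · rw [uIcc_of_ge hcs] at ht
      exact (hs0.trans_le ht.1).ne h0
  · have := ht.2
    exact (this.trans_lt (max_lt hc1 hs1)).ne h1

/-- If no iterate of `g` preserves a fibre of the retraction `π` over the open interval at its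
point on the arc `φ`, and `g` sends the initial point of the arc over the open interval, then every
iterate of `g` moves all points of the open arc towards its terminal point. -/
theorem lt_proj_iterate {X : Type*} [TopologicalSpace X] {φ : unitInterval → X}
    (hφ : Continuous φ) {π : X → unitInterval} (hπ : Continuous π) (hπφ : ∀ u, π (φ u) = u)
    (hopen : ∀ u, IsOpen (π ⁻¹' {u} \ {φ u})) {g : X → X} (hg : Continuous g)
    (hfix : ∀ k, 0 < k → ∀ s, 0 < s → s < 1 → π (g^[k] (φ s)) ≠ s)
    (h0 : 0 < π (g (φ 0))) (h1 : π (g (φ 0)) < 1) {k : ℕ} (hk : 0 < k) {s : unitInterval}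
    (hs0 : 0 < s) (hs1 : s < 1) : s < π (g^[k] (φ s)) := by
  have hcont : ∀ k, Continuous fun s => π (g^[k] (φ s)) := fun k =>
    hπ.comp ((hg.iterate k).comp hφ)
  have hbase : ∀ s, 0 < s → s < 1 → s < π (g (φ s)) := fun s hs0 hs1 =>
    unitInterval.lt_of_forall_ne (hcont 1) (hfix 1 one_pos) zero_lt_one h0 hs0 hs1
  set u := π (g (φ 0))
  obtain ⟨c, hcu, hc⟩ : ∃ c < u, g (φ c) = φ u := by
    by_contra! hcon
    have hne : ∀ c ∈ Icc 0 u, g (φ c) ≠ φ u := by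
      rintro c ⟨-, hc⟩ h
      rcases hc.eq_or_lt with rfl | hc
      · exact (hbase _ h0 h1).ne' (by rw [h, hπφ])
      · exact hcon c hc h
    have hpre : IsPreconnected ((fun c => g (φ c)) '' Icc 0 u) :=
      isPreconnected_Icc.image _ (hg.comp hφ).continuousOn
    have hsub := hpre.subset_of_closure_inter_subset (hopen u)
      ⟨_, ⟨0, ⟨le_rfl, h0.le⟩, rfl⟩, rfl, hne 0 ⟨le_rfl, h0.le⟩⟩ (by
        rintro _ ⟨hcl, c, hc, rfl⟩
        refine ⟨?_, hne c hc⟩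
        exact closure_minimal sdiff_subset (isClosed_singleton.preimage hπ) hcl)
    have : π (g (φ u)) = u := (hsub ⟨u, ⟨h0.le, le_rfl⟩, rfl⟩).1
    exact (hbase u h0 h1).ne' this
  induction k, hk using Nat.le_induction generalizing s with
  | base => exact hbase s hs0 hs1
  | succ k hk ih =>
    refine unitInterval.lt_of_forall_ne (hcont (k + 1)) (hfix (k + 1) k.succ_pos)
      (hcu.trans h1) ?_ hs0 hs1
    rw [Function.iterate_succ_apply, hc]
    exact hcu.trans (ih h0 h1)

/-- If both endpoints of an arc `[x,y]` in a dendrite return into the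
connected component `U` of `D \ {x,y}` containing the open arc `(x,y)`, then `U`
contains a periodic point. -/
theorem stmt3 {D : Type*} [MetricSpace D] [CompactSpace D] [ConnectedSpace D]
    (hD : IsDendrite D) {f : D → D} (hf : Continuous f)
    {x y : D} (hxy : x ≠ y) {A : Set D} (hA : IsArcEnds A x y)
    {w : D} (hwA : w ∈ A) (hwx : w ≠ x) (hwy : w ≠ y)
    {U : Set D} (hU : U = connectedComponentIn ({x, y}ᶜ : Set D) w)
    {m n : ℕ} (hm : 0 < m) (hn : 0 < n) (hfx : f^[m] x ∈ U) (hfy : f^[n] y ∈ U) :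
    ∃ p ∈ U, IsPeriodic f p := by
  obtain ⟨e, he0, he1⟩ := hA
  let φ : unitInterval → D := fun t => e t
  have hφ : Continuous φ := continuous_subtype_val.comp e.continuous
  have hinj : Function.Injective φ := Subtype.val_injective.comp e.injective
  have hφ0 : φ 0 = x := he0
  have hφ1 : φ 1 = y := he1
  obtain ⟨π, hπ, hπφ, hopen⟩ := hD.exists_retraction hφ hinj
  have hπx : π x = 0 := hφ0 ▸ hπφ 0
  have hπy : π y = 1 := hφ1 ▸ hπφ 1
  obtain ⟨ω, rfl⟩ : ∃ ω, φ ω = w := ⟨e.symm ⟨w, hwA⟩, by simp [φ]⟩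
  have hω0 : 0 < ω := lt_of_le_of_ne ω.2.1 fun h => hwx (h ▸ hφ0)
  have hω1 : ω < 1 := lt_of_le_of_ne ω.2.2 fun h => hwy (h ▸ hφ1)
  have hUpre : IsPreconnected U := hU ▸ isPreconnected_connectedComponentIn
  have hUsub : U ⊆ {x, y}ᶜ := hU ▸ connectedComponentIn_subset _ _
  have hwU : φ ω ∈ U := hU ▸ mem_connectedComponentIn (by simp [hwx, hwy])
  have hmemU : ∀ p, 0 < π p → π p < 1 → p ∈ U := by
    intro p h0 h1
    obtain ⟨q, hq, hqmem, hqid, -⟩ :=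
      exists_continuous_retraction_fiber hπ (hπφ (π p)) (hopen (π p))
    have hS : IsPreconnected (φ '' Ioo 0 1 ∪ range q) :=
      (isPreconnected_Ioo.image _ hφ.continuousOn).union (φ (π p)) ⟨π p, ⟨h0, h1⟩, rfl⟩
        ⟨φ (π p), hqid _ (hπφ _)⟩ (isPreconnected_range hq)
    rw [hU]
    refine hS.subset_connectedComponentIn (Or.inl ⟨ω, ⟨hω0, hω1⟩, rfl⟩) ?_
      (Or.inr ⟨p, hqid p rfl⟩)
    have hpos : ∀ d ∈ φ '' Ioo 0 1 ∪ range q, 0 < π d ∧ π d < 1 := by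
      rintro _ (⟨t, ht, rfl⟩ | ⟨d, rfl⟩)
      · rwa [hπφ]
      · rw [hqmem]
        exact ⟨h0, h1⟩
    rintro d hd (rfl | rfl)
    · exact (hpos d hd).1.ne' hπx
    · exact (hpos d hd).2.ne hπy
  have hUfib : ∀ u, φ u ∉ U → ∀ p ∈ U, π p ≠ u := by
    intro u hu p hp hpu
    have hsub := hUpre.subset_of_closure_inter_subset (hopen u)
      ⟨p, hp, hpu, fun h => hu (h ▸ hp)⟩
      (fun d hd => ⟨closure_minimal sdiff_subset (isClosed_singleton.preimage hπ) hd.1,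
        fun h => hu (h ▸ hd.2)⟩)
    have hωu : ω = u := (hπφ ω).symm.trans (hsub hwU).1
    exact hu (hωu ▸ hwU)
  have hU0 : ∀ p ∈ U, 0 < π p := fun p hp => lt_of_le_of_ne (π p).2.1
    (hUfib 0 (fun h => hUsub h (Or.inl hφ0)) p hp).symm
  have hU1 : ∀ p ∈ U, π p < 1 := fun p hp => lt_of_le_of_ne (π p).2.2
    (hUfib 1 (fun h => hUsub h (Or.inr hφ1)) p hp)
  by_contra! hper
  have hfix : ∀ k, 0 < k → ∀ s, 0 < s → s < 1 → π (f^[k] (φ s)) ≠ s := by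
    intro k hk s hs0 hs1 hs
    obtain ⟨p, hps, hp⟩ :=
      hD.exists_fixedPoint_mem_fiber hπ (hπφ s) (hopen s) (hf.iterate k) hs
    exact hper p (hmemU p (hps ▸ hs0) (hps ▸ hs1)) ⟨k, hk, hp⟩
  have hup : ω < π ((f^[m])^[n] (φ ω)) := by
    refine lt_proj_iterate hφ hπ hπφ hopen (hf.iterate m) (fun k hk s hs0 hs1 => ?_)
      (hU0 _ (hφ0 ▸ hfx)) (hU1 _ (hφ0 ▸ hfx)) hn hω0 hω1
    rw [← Function.iterate_mul]
    exact hfix _ (Nat.mul_pos hm hk) s hs0 hs1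
  have hpos : ∀ t : unitInterval, t < 1 → 0 < unitInterval.symm t := fun t ht =>
    unitInterval.lt_symm_comm.2 (unitInterval.symm_zero ▸ ht)
  have hlt : ∀ t : unitInterval, 0 < t → unitInterval.symm t < 1 := fun t ht =>
    unitInterval.symm_lt_comm.2 (unitInterval.symm_one ▸ ht)
  have hφσ : (φ ∘ unitInterval.symm) 0 = y := by
    rw [Function.comp_apply, unitInterval.symm_zero, hφ1]
  have hdown : unitInterval.symm ω <
      unitInterval.symm (π ((f^[n])^[m] (φ (unitInterval.symm (unitInterval.symm ω))))) := by
    refine lt_proj_iterate (φ := φ ∘ unitInterval.symm) (π := unitInterval.symm ∘ π)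
      (hφ.comp unitInterval.continuous_symm) (unitInterval.continuous_symm.comp hπ)
      (fun u => by simp [hπφ]) (fun u => ?_) (hf.iterate n) (fun k hk s hs0 hs1 hs => ?_)
      (hpos _ (hU1 _ (hφσ ▸ hfy))) (hlt _ (hU0 _ (hφσ ▸ hfy))) hm (hpos ω hω1) (hlt ω hω0)
    · convert hopen (unitInterval.symm u) using 2
      · ext p
        exact unitInterval.symm_involutive.eq_iff
      · rfl
    · rw [← Function.iterate_mul] at hs
      exact hfix _ (Nat.mul_pos hn hk) (unitInterval.symm s) (hpos s hs1) (hlt s hs0)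
        (unitInterval.symm_involutive.eq_iff.1 hs)
  rw [unitInterval.symm_symm, unitInterval.symm_lt_symm, ← Function.iterate_mul, mul_comm n m,
    Function.iterate_mul] at hdown
  exact hup.not_gt hdown
end

section
/- Let D be a dendrite and f : D → D a continuous map. If there exists a point x ∈ D \ End(D) whose orbit under f is dense in D, then the set Per(f) of periodic points of f is dense in D. -/
open Set Topology Filter TopologicalSpace

/-- `z` lies between `a` and `b`: it is one of the two points or separates them. -/
def CutsBetween {X : Type*} [TopologicalSpace X] (a z b : X) : Prop :=
  b ∉ connectedComponentIn ({z}ᶜ : Set X) a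

namespace CutsBetween

section Basic

variable {X : Type*} [TopologicalSpace X] {a b c z : X}

theorem left (a b : X) : CutsBetween a a b := fun h =>
  (connectedComponentIn_nonempty_iff.1 ⟨b, h⟩) rfl

theorem right (a b : X) : CutsBetween a b b := fun h =>
  connectedComponentIn_subset _ _ h rfl

theorem not_symm (h : ¬ CutsBetween a z b) : ¬ CutsBetween b z a := by
  have h : b ∈ connectedComponentIn ({z}ᶜ : Set X) a := not_not.1 h
  have ha : a ∈ ({z}ᶜ : Set X) := connectedComponentIn_nonempty_iff.1 ⟨b, h⟩
  refine not_not.2 ?_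
  rw [← connectedComponentIn_eq h]
  exact mem_connectedComponentIn ha

theorem symm (h : CutsBetween a z b) : CutsBetween b z a :=
  not_imp_not.1 not_symm h

theorem not_trans (h₁ : ¬ CutsBetween a z b) (h₂ : ¬ CutsBetween b z c) :
    ¬ CutsBetween a z c := by
  have h₁ : b ∈ connectedComponentIn ({z}ᶜ : Set X) a := not_not.1 h₁
  unfold CutsBetween at *
  rwa [connectedComponentIn_eq h₁]

theorem of_not_left (h₁ : CutsBetween a z b) (h₂ : ¬ CutsBetween a z c) : CutsBetween c z b :=
  not_imp_not.1 (not_trans h₂) h₁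

theorem of_not_right (h₁ : CutsBetween a z b) (h₂ : ¬ CutsBetween b z c) : CutsBetween a z c :=
  (h₁.symm.of_not_left h₂).symm

theorem not_refl (h : a ≠ z) : ¬ CutsBetween a z a :=
  not_not.2 (mem_connectedComponentIn h)

theorem eq_of_refl (h : CutsBetween a z a) : z = a := by
  by_contra hne
  exact not_refl (Ne.symm hne) h

theorem ne_left (h : ¬ CutsBetween a z b) : a ≠ z := by
  rintro rfl
  exact h (left _ _)

theorem ne_right (h : ¬ CutsBetween a z b) : b ≠ z := ne_left (not_symm h)

/-- A preconnected set missing `z` lies on one side of `z`. -/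
theorem not_of_isPreconnected {s : Set X} (hs : IsPreconnected s) (ha : a ∈ s) (hb : b ∈ s)
    (hz : z ∉ s) : ¬ CutsBetween a z b :=
  not_not.2 <| hs.subset_connectedComponentIn ha (subset_compl_singleton_iff.2 hz) hb

end Basic

section Continuum

variable {X : Type*} [TopologicalSpace X] [T2Space X] [CompactSpace X] [ConnectedSpace X]
  {a b c z w : X}

theorem mem_closure_component (h : a ≠ z) :
    z ∈ closure (connectedComponentIn ({z}ᶜ : Set X) a) := by
  by_contra hz
  set C := connectedComponentIn ({z}ᶜ : Set X) a with hC
  obtain ⟨V, hVo, hCV, hVz⟩ := normal_exists_closure_subset (isClosed_closure (s := C))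
    (isOpen_compl_singleton (x := z)) (fun y hy e => hz (e ▸ hy))
  have haC : a ∈ C := mem_connectedComponentIn h
  have haV : a ∈ closure V := subset_closure (hCV (subset_closure haC))
  let K := closure V
  have : CompactSpace K := isCompact_iff_compactSpace.1 isClosed_closure.isCompact
  have hcomp : connectedComponent (⟨a, haV⟩ : K) ⊆ (Subtype.val ⁻¹' V : Set K) := by
    intro y hy
    apply hCV
    apply subset_closure
    refine (isPreconnected_connectedComponent.image (Subtype.val : K → X)
      continuous_subtype_val.continuousOn).subset_connectedComponentIn
      ⟨_, mem_connectedComponent, rfl⟩ ?_ ⟨y, hy, rfl⟩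
    rintro _ ⟨w, -, rfl⟩
    exact hVz w.2
  rw [connectedComponent_eq_iInter_isClopen] at hcomp
  have : Nonempty {s : Set K // IsClopen s ∧ (⟨a, haV⟩ : K) ∈ s} :=
    ⟨⟨univ, isClopen_univ, mem_univ _⟩⟩
  obtain ⟨⟨Z, hZ, haZ⟩, hZV⟩ := exists_subset_nhds_of_compactSpace
    (V := fun s : {s : Set K // IsClopen s ∧ (⟨a, haV⟩ : K) ∈ s} => (s : Set K))
    (by
      rintro ⟨s, hs, has⟩ ⟨t, ht, hat⟩
      exact ⟨⟨s ∩ t, hs.inter ht, has, hat⟩, inter_subset_left, inter_subset_right⟩)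
    (fun s => s.2.1.1)
    (fun y hy => (hVo.preimage continuous_subtype_val).mem_nhds (hcomp hy))
  have hZclosed : IsClosed (Subtype.val '' Z : Set X) :=
    isClosed_closure.isClosedEmbedding_subtypeVal.isClosedMap _ hZ.1
  have hZopen : IsOpen (Subtype.val '' Z : Set X) := by
    obtain ⟨O, hO, hOZ⟩ := isOpen_induced_iff.1 hZ.2
    have : (Subtype.val '' Z : Set X) = O ∩ V := by
      ext y
      constructor
      · rintro ⟨w, hw, rfl⟩
        exact ⟨by rw [← hOZ] at hw; exact hw, hZV hw⟩
      · rintro ⟨hyO, hyV⟩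
        exact ⟨⟨y, subset_closure hyV⟩, by rw [← hOZ]; exact hyO, rfl⟩
    rw [this]
    exact hO.inter hVo
  have := IsClopen.eq_univ ⟨hZclosed, hZopen⟩ ⟨a, _, haZ, rfl⟩
  obtain ⟨w, -, hw⟩ : z ∈ (Subtype.val '' Z : Set X) := this ▸ mem_univ z
  exact hVz w.2 hw

theorem isPreconnected_insert_component (h : a ≠ z) :
    IsPreconnected (insert z (connectedComponentIn ({z}ᶜ : Set X) a)) :=
  isPreconnected_connectedComponentIn.subset_closure (subset_insert _ _)
    (insert_subset (mem_closure_component h) subset_closure)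

theorem isPreconnected_compl_component :
    IsPreconnected (connectedComponentIn ({z}ᶜ : Set X) a)ᶜ := by
  refine isPreconnected_of_forall z fun s hs => ?_
  rcases eq_or_ne s z with rfl | hsz
  · exact ⟨{s}, by simpa using hs, rfl, rfl, isPreconnected_singleton⟩
  · refine ⟨_, ?_, Set.mem_insert _ _, mem_insert_of_mem _ (mem_connectedComponentIn hsz),
      isPreconnected_insert_component hsz⟩
    refine insert_subset (right a z) fun y hy hya => ?_
    exact not_trans (not_not.2 hya) (not_symm (not_not.2 hy)) hs

theorem antisymm (h : CutsBetween a z b) (h' : CutsBetween z a b) : a = z := by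
  by_contra hne
  exact not_of_isPreconnected isPreconnected_compl_component (right a z) h
    (not_not.2 (mem_connectedComponentIn hne)) h'

/-- `[a, z] ⊆ [a, b]` when `z ∈ [a, b]`. -/
theorem mono (h : CutsBetween a z b) (hw : CutsBetween a w z) : CutsBetween a w b := by
  by_contra hab
  have h₁ : CutsBetween b w z := hw.of_not_left hab
  by_cases hzw : z = w
  · exact hab (hzw ▸ h)
  · have haz : ¬ CutsBetween w z a := fun h' => hzw (antisymm hw.symm h')
    have hbz : ¬ CutsBetween w z b := fun h' => hzw (antisymm h₁.symm h')
    exact not_trans (not_symm haz) hbz h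

theorem mono_right (h : CutsBetween a z b) (hw : CutsBetween a w z) : CutsBetween w z b := by
  by_contra hwb
  have h₁ : CutsBetween w z a := (h.of_not_right (not_symm hwb)).symm
  obtain rfl := antisymm hw.symm h₁
  exact hwb (left _ _)

theorem left_trans (h₁ : CutsBetween a z b) (h₂ : CutsBetween z w b) : CutsBetween a w b :=
  (h₁.symm.mono h₂.symm).symm

theorem total (h₁ : CutsBetween a z b) (h₂ : CutsBetween a w b) :
    CutsBetween a z w ∨ CutsBetween a w z := by
  by_contra! h
  have h₃ : CutsBetween w z b := h₁.of_not_left h.1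
  have h₄ : CutsBetween z w b := h₂.of_not_left h.2
  obtain rfl := antisymm h₃ h₄
  exact h.1 (right _ _)

/-- A component of the complement of `s`, together with `s`, is convex. -/
theorem half_convex {r : X} (hb : b = z ∨ ¬ CutsBetween a z b)
    (hc : c = z ∨ ¬ CutsBetween a z c) (hr : CutsBetween b r c) :
    r = z ∨ ¬ CutsBetween a z r := by
  by_contra! h
  have key : ∀ b, (b = z ∨ ¬ CutsBetween a z b) → ¬ CutsBetween z r b := by
    rintro b (rfl | hb) h'
    · exact h.1 (eq_of_refl h')
    · exact h.1 (antisymm (h.2.of_not_left hb).symm h')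
  exact not_trans (not_symm (key b hb)) (key c hc) hr

end Continuum

end CutsBetween

namespace IsDendrite

section Topology

variable {X : Type*} [TopologicalSpace X] {a b w x y z : X}

theorem exists_between (hD : IsDendrite X) (h : a ≠ b) :
    ∃ z, z ≠ a ∧ z ≠ b ∧ CutsBetween a z b := by
  obtain ⟨z, hza, hzb, hz⟩ := hD.2 a b h
  exact ⟨z, hza, hzb, fun hb => hz (connectedComponentIn_eq hb)⟩

variable [T2Space X] [CompactSpace X] [ConnectedSpace X]

theorem isOpen_side (hD : IsDendrite X) (z a : X) : IsOpen {p | ¬ CutsBetween a z p} := by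
  rw [isOpen_iff_mem_nhds]
  intro p hp
  by_contra hnhds
  have hz : z ∈ {p | ¬ CutsBetween a z p}ᶜ := not_not.2 (CutsBetween.right a z)
  have hcl : p ∈ closure {p | ¬ CutsBetween a z p}ᶜ := by
    rw [mem_closure_iff_nhds]
    intro t ht
    by_contra hne
    refine hnhds (mem_of_superset ht fun q hq => ?_)
    by_contra hq'
    exact hne ⟨q, hq, hq'⟩
  have hcompl : {p | ¬ CutsBetween a z p}ᶜ = (connectedComponentIn ({z}ᶜ : Set X) a)ᶜ := by
    ext q
    simp [CutsBetween]
  have haz := CutsBetween.ne_left hp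
  obtain ⟨w, hwp, hwz, hw⟩ := hD.exists_between (CutsBetween.ne_right hp)
  by_cases hwC : CutsBetween a z w
  · refine CutsBetween.not_of_isPreconnected (CutsBetween.isPreconnected_insert_component haz)
      (mem_insert_of_mem _ (not_not.1 hp)) (Set.mem_insert _ _) ?_ hw
    rintro (h | h)
    · exact hwz h
    · exact hwC h
  · have hconn : IsPreconnected (insert p {p | ¬ CutsBetween a z p}ᶜ) := by
      refine IsPreconnected.subset_closure (s := {p | ¬ CutsBetween a z p}ᶜ) ?_
        (subset_insert _ _) (insert_subset hcl subset_closure)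
      rw [hcompl]
      exact CutsBetween.isPreconnected_compl_component
    refine CutsBetween.not_of_isPreconnected hconn (Set.mem_insert _ _)
      (mem_insert_of_mem _ hz) ?_ hw
    rintro (h | h)
    · exact hwp h
    · exact h hwC

theorem isOpen_far_side (hD : IsDendrite X) (z a : X) :
    IsOpen {p | p ≠ z ∧ CutsBetween a z p} := by
  have : {p | p ≠ z ∧ CutsBetween a z p} =
      ⋃ q ∈ {q | CutsBetween a z q}, {p | ¬ CutsBetween q z p} := by
    ext p
    simp only [mem_ofPred_eq, mem_iUnion, exists_prop]
    constructor
    · rintro ⟨hpz, hp⟩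
      exact ⟨p, hp, CutsBetween.not_refl hpz⟩
    · rintro ⟨q, hq, hp⟩
      exact ⟨CutsBetween.ne_right hp, hq.of_not_right hp⟩
  rw [this]
  exact isOpen_biUnion fun q _ => hD.isOpen_side z q

theorem isClosed_half (hD : IsDendrite X) (z a : X) :
    IsClosed {p | p = z ∨ ¬ CutsBetween a z p} := by
  rw [← isOpen_compl_iff]
  convert hD.isOpen_far_side z a using 1
  ext p
  simp

/-- Two points on the same side of `w` are both cut from `w` by a common point. -/
theorem exists_common_between (hD : IsDendrite X) (h : ¬ CutsBetween a w b) :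
    ∃ u, u ≠ w ∧ CutsBetween w u a ∧ CutsBetween w u b := by
  refine IsPreconnected.induction₂ (s := connectedComponentIn ({w}ᶜ : Set X) a)
    isPreconnected_connectedComponentIn
    (fun a b => ∃ u, u ≠ w ∧ CutsBetween w u a ∧ CutsBetween w u b) ?_ ?_ ?_
    (mem_connectedComponentIn (CutsBetween.ne_left h)) (not_not.1 h)
  · intro p hp
    obtain ⟨z, hzw, hzp, hz⟩ := hD.exists_between (CutsBetween.ne_right (not_not.2 hp)).symm
    have := (hD.isOpen_far_side z w).mem_nhds ⟨hzp.symm, hz⟩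
    filter_upwards [mem_nhdsWithin_of_mem_nhds this] with q hq
    exact ⟨z, hzw, hz, hq.2⟩
  · rintro p q r - - - ⟨u, hu, hup, huq⟩ ⟨v, hv, hvq, hvr⟩
    rcases huq.total hvq with h | h
    · exact ⟨u, hu, hup, hvr.mono h⟩
    · exact ⟨v, hv, hup.mono h, hvr⟩
  · rintro p q - - ⟨u, hu, hp, hq⟩
    exact ⟨u, hu, hq, hp⟩

theorem exists_between_compact (hD : IsDendrite X) (hyx : y ≠ x) {K : Set X} (hK : IsCompact K)
    (hKC : ∀ k ∈ K, ¬ CutsBetween y x k) :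
    ∃ u, ¬ CutsBetween y x u ∧ ∀ k ∈ K, CutsBetween x u k := by
  suffices ∃ u, ¬ CutsBetween y x u ∧ ∀ k ∈ K, ¬ CutsBetween y x k → CutsBetween x u k by
    obtain ⟨u, hu, h⟩ := this
    exact ⟨u, hu, fun k hk => h k hk (hKC k hk)⟩
  refine hK.induction_on
    (p := fun S => ∃ u, ¬ CutsBetween y x u ∧ ∀ k ∈ S, ¬ CutsBetween y x k → CutsBetween x u k)
    ⟨y, CutsBetween.not_refl hyx, by simp⟩ ?_ ?_ ?_
  · rintro s t hst ⟨u, hu, h⟩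
    exact ⟨u, hu, fun k hk => h k (hst hk)⟩
  · rintro s t ⟨u, hu, h⟩ ⟨v, hv, h'⟩
    obtain ⟨r, hr, hru, hrv⟩ :=
      hD.exists_common_between (CutsBetween.not_trans (CutsBetween.not_symm hu) hv)
    refine ⟨r, CutsBetween.not_trans hu fun h => hr (CutsBetween.antisymm hru h.symm).symm, ?_⟩
    rintro k (hk | hk) hyk
    · exact (h k hk hyk).mono hru
    · exact (h' k hk hyk).mono hrv
  · intro k hk
    have hyk := hKC k hk
    obtain ⟨z, hzx, hzk, hz⟩ := hD.exists_between (CutsBetween.ne_right hyk).symm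
    refine ⟨_, mem_nhdsWithin_of_mem_nhds ((hD.isOpen_far_side z x).mem_nhds ⟨hzk.symm, hz⟩), z,
      CutsBetween.not_trans hyk fun h => hzx (CutsBetween.antisymm hz h.symm).symm, ?_⟩
    rintro q ⟨-, hq⟩ -
    exact hq

/-- Being strictly on one side is an open condition, jointly in the cutting point. -/
theorem eventually_not_cutsBetween (hD : IsDendrite X) (h : ¬ CutsBetween a w b) :
    ∀ᶠ p : X × X in 𝓝 (w, b), ¬ CutsBetween a p.1 p.2 := by
  obtain ⟨K, hKb, hKC, hK⟩ := local_compact_nhds ((hD.isOpen_side w a).mem_nhds h)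
  obtain ⟨u, hu, hKu⟩ := hD.exists_between_compact (CutsBetween.ne_left h)
    (hK.union (isCompact_singleton (x := a))) (by
      rintro k (hk | rfl)
      · exact hKC hk
      · exact CutsBetween.not_refl (CutsBetween.ne_left h))
  have huw : w ≠ u := (CutsBetween.ne_right hu).symm
  have hN := (hD.isOpen_side u w).mem_nhds (CutsBetween.not_refl huw)
  rw [nhds_prod_eq]
  filter_upwards [prod_mem_prod hN hKb] with p hp
  have key : ∀ k ∈ K ∪ {a}, ¬ CutsBetween u p.1 k := fun k hk h' =>
    CutsBetween.ne_right hp.1 (CutsBetween.antisymm ((hKu k hk).of_not_left hp.1) h')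
  exact CutsBetween.not_trans (CutsBetween.not_symm (key a (Or.inr rfl)))
    (key p.2 (Or.inl hp.2))

theorem isClosed_segment (hD : IsDendrite X) (a b : X) : IsClosed {s | CutsBetween a s b} := by
  rw [← isOpen_compl_iff, isOpen_iff_mem_nhds]
  intro s hs
  have : Tendsto (fun s : X => (s, b)) (𝓝 s) (𝓝 (s, b)) := by
    exact (Continuous.prodMk_left b).tendsto s
  exact this.eventually (hD.eventually_not_cutsBetween hs)

theorem isOpen_moved_toward (hD : IsDendrite X) {g : X → X} (hg : Continuous g) (a : X) :
    IsOpen {s | ¬ CutsBetween a s (g s)} := by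
  rw [isOpen_iff_mem_nhds]
  intro s hs
  have : Tendsto (fun s : X => (s, g s)) (𝓝 s) (𝓝 (s, g s)) :=
    (continuous_id.prodMk hg).tendsto s
  exact this.eventually (hD.eventually_not_cutsBetween hs)

/-- A nonempty compact set has a point that is first as seen from `x`. -/
theorem exists_first (hD : IsDendrite X) (x : X) {B : Set X} (hB : IsCompact B)
    (hne : B.Nonempty) : ∃ m ∈ B, ∀ s ∈ B, CutsBetween x s m → s = m := by
  by_contra! hmin
  have key : ∀ b ∈ B, ∃ m ∈ B, CutsBetween x m b ∧ ∀ s ∈ B, ¬ CutsBetween x s m := by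
    refine hB.induction_on
      (p := fun S => ∀ b ∈ B, ∃ m ∈ B, CutsBetween x m b ∧ ∀ s ∈ S, ¬ CutsBetween x s m)
      (fun b hb => ⟨b, hb, CutsBetween.right _ _, by simp⟩) ?_ ?_ ?_
    · intro S T hST h b hb
      obtain ⟨m, hm, hmb, h'⟩ := h b hb
      exact ⟨m, hm, hmb, fun s hs => h' s (hST hs)⟩
    · intro S T hS hT b hb
      obtain ⟨m, hm, hmb, h⟩ := hS b hb
      obtain ⟨l, hl, hlm, h'⟩ := hT m hm
      refine ⟨l, hl, hmb.mono hlm, ?_⟩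
      rintro s (hs | hs)
      · exact fun hsl => h s hs (hlm.mono hsl)
      · exact h' s hs
    · intro p hp
      obtain ⟨s, hs, hsp, hne⟩ := hmin p hp
      refine ⟨_, mem_nhdsWithin_of_mem_nhds
        ((hD.isOpen_far_side s x).mem_nhds ⟨hne.symm, hsp⟩), fun b hb => ?_⟩
      by_cases h : ∃ q ∈ {q | q ≠ s ∧ CutsBetween x s q}, CutsBetween x q b
      · obtain ⟨q, hq, hqb⟩ := h
        refine ⟨s, hs, hqb.mono hq.2, fun r hr hrs => hr.1 ?_⟩
        exact (CutsBetween.eq_of_refl (hr.2.mono_right hrs)).symm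
      · push Not at h
        exact ⟨b, hb, CutsBetween.right _ _, h⟩
  obtain ⟨b, hb⟩ := hne
  obtain ⟨m, hm, -, h⟩ := key b hb
  exact h m hm (CutsBetween.right _ _)

/-- Points between `w` and `a` accumulate at `w`. -/
theorem exists_between_near (hD : IsDendrite X) (h : w ≠ a) {N : Set X} (hN : N ∈ 𝓝 w) :
    ∃ u ∈ N, u ≠ w ∧ CutsBetween w u a := by
  by_contra! hc
  have hB : IsCompact ({s | CutsBetween w s a} ∩ (interior N)ᶜ) :=
    ((hD.isClosed_segment w a).inter isOpen_interior.isClosed_compl).isCompact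
  obtain ⟨m, hm, hmin⟩ := hD.exists_first w hB
    ⟨a, CutsBetween.right _ _, fun ha => hc a (interior_subset ha) h.symm (CutsBetween.right _ _)⟩
  have hwm : w ≠ m := by
    rintro rfl
    exact hm.2 (mem_interior_iff_mem_nhds.2 hN)
  obtain ⟨u, huw, hum, hu⟩ := hD.exists_between hwm
  have hua : CutsBetween w u a := CutsBetween.mono hm.1 hu
  refine hum (hmin u ⟨hua, fun hi => hc u (interior_subset hi) huw hua⟩ hu)

theorem exists_common_between_near (hD : IsDendrite X) (h : ¬ CutsBetween a w b) {N : Set X}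
    (hN : N ∈ 𝓝 w) : ∃ u ∈ N, u ≠ w ∧ CutsBetween w u a ∧ CutsBetween w u b := by
  obtain ⟨v, hv, hva, hvb⟩ := hD.exists_common_between h
  obtain ⟨u, huN, hu, huv⟩ := hD.exists_between_near hv.symm hN
  exact ⟨u, huN, hu, hva.mono huv, hvb.mono huv⟩

theorem exists_median (hD : IsDendrite X) (x y z : X) :
    ∃ m, CutsBetween x m y ∧ CutsBetween y m z ∧ CutsBetween z m x := by
  obtain ⟨m, hm, hmin⟩ := hD.exists_first z (hD.isClosed_segment x y).isCompact
    ⟨x, CutsBetween.left _ _⟩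
  refine ⟨m, hm, ?_, ?_⟩
  · by_contra h
    obtain ⟨t, ht, hty, htz⟩ := hD.exists_common_between h
    exact ht (hmin t (CutsBetween.mono hm.symm hty.symm).symm htz.symm)
  · by_contra h
    obtain ⟨t, ht, htz, htx⟩ := hD.exists_common_between h
    exact ht (hmin t (CutsBetween.mono hm htx.symm) htz.symm)

end Topology

end IsDendrite

/-- The union of `{a, b}` and of everything lying between `a` and `b`, side branches included. -/
def cutInterval {X : Type*} [TopologicalSpace X] (a b : X) : Set X :=
  {s | (s = a ∨ ¬ CutsBetween b a s) ∧ (s = b ∨ ¬ CutsBetween a b s)}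

namespace IsDendrite

section Helly

variable {X : Type*} [TopologicalSpace X] [T2Space X] [CompactSpace X] [ConnectedSpace X]

/-- Helly's theorem for convex subsets of a dendrite. -/
theorem helly (hD : IsDendrite X) {ι : Type*} (H : ι → Set X)
    (hH : ∀ i, ∀ b ∈ H i, ∀ c ∈ H i, ∀ r, CutsBetween b r c → r ∈ H i)
    (hp : ∀ i j, (H i ∩ H j).Nonempty) (F : Finset ι) :
    ∀ A : Set X, A.Nonempty → (∀ b ∈ A, ∀ c ∈ A, ∀ r, CutsBetween b r c → r ∈ A) →
      (∀ i ∈ F, (A ∩ H i).Nonempty) → (A ∩ ⋂ i ∈ F, H i).Nonempty := by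
  classical
  induction F using Finset.induction_on with
  | empty =>
    intro A hA _ _
    simpa using hA
  | insert i F _ ih =>
    intro A hA hconv hAF
    have := ih (A ∩ H i) (hAF i (Finset.mem_insert_self _ _))
      (fun b hb c hc r hr => ⟨hconv b hb.1 c hc.1 r hr, hH i b hb.2 c hc.2 r hr⟩) fun j hj => by
        obtain ⟨p, hpA, hpi⟩ := hAF i (Finset.mem_insert_self _ _)
        obtain ⟨q, hqA, hqj⟩ := hAF j (Finset.mem_insert_of_mem hj)
        obtain ⟨r, hri, hrj⟩ := hp i j
        obtain ⟨m, h₁, h₂, h₃⟩ := hD.exists_median p q r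
        exact ⟨m, ⟨hconv p hpA q hqA m h₁, hH i r hri p hpi m h₃⟩, hH j q hqj r hrj m h₂⟩
    rwa [Finset.set_biInter_insert, ← inter_assoc]

end Helly

section FixedPoint

variable {X : Type*} [TopologicalSpace X] [T2Space X] [CompactSpace X] [ConnectedSpace X]
  {g : X → X} {p q : X}

/-- If the ends of a segment are moved away from each other, the segment has a fixed point. -/
theorem exists_fixed_of_away (hD : IsDendrite X) (hg : Continuous g) (hpq : p ≠ q)
    (hp : CutsBetween q p (g p)) (hq : CutsBetween p q (g q)) :
    ∃ s, CutsBetween p s q ∧ g s = s := by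
  by_contra! hfix
  have hopen := hD.isOpen_moved_toward hg
  have hpN : ¬ CutsBetween (g p) p (g p) := CutsBetween.not_refl (hfix p (CutsBetween.left _ _))
  have hB : IsCompact ({s | CutsBetween p s q} ∩
      ({s | ¬ CutsBetween p s (g s)}ᶜ ∩ {s | ¬ CutsBetween (g p) s (g s)}ᶜ)) :=
    ((hD.isClosed_segment p q).inter
      ((hopen p).isClosed_compl.inter (hopen (g p)).isClosed_compl)).isCompact
  have memB : ∀ s, CutsBetween p s q → s ≠ p → CutsBetween p s (g s) →
      s ∈ {s | CutsBetween p s q} ∩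
        ({s | ¬ CutsBetween p s (g s)}ᶜ ∩ {s | ¬ CutsBetween (g p) s (g s)}ᶜ) := by
    refine fun s hs hsp hsg => ⟨hs, not_not.2 hsg, fun h => ?_⟩
    have h₁ : CutsBetween s p (g p) := CutsBetween.mono_right hp hs.symm
    exact CutsBetween.not_trans (fun h' => hsp (CutsBetween.antisymm h₁ h')) h hsg
  obtain ⟨m, ⟨hm, hmp, hmN⟩, hmin⟩ := hD.exists_first p hB
    ⟨q, memB q (CutsBetween.right _ _) hpq.symm hq⟩
  have hmp : CutsBetween p m (g m) := not_not.1 hmp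
  have hmne : m ≠ p := by
    rintro rfl
    exact hmN hpN
  have hO := ((hopen (g m)).inter (isOpen_compl_singleton (x := p))).mem_nhds
    ⟨CutsBetween.not_refl (hfix m hm), hmne⟩
  obtain ⟨t, ⟨htO, htp⟩, htm, ht⟩ := hD.exists_between_near hmne hO
  refine htm (hmin t (memB t (hm.mono ht.symm) htp ?_) ht.symm)
  exact (hmp.mono ht.symm).of_not_right htO

theorem segment_subset_cutInterval {s : X} (hs : CutsBetween p s q) : s ∈ cutInterval p q := by
  refine ⟨or_iff_not_imp_left.2 fun hsp h => hsp ?_, or_iff_not_imp_left.2 fun hsq h => hsq ?_⟩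
  · exact CutsBetween.eq_of_refl (hs.symm.mono_right h)
  · exact CutsBetween.eq_of_refl (hs.mono_right h)

theorem cutInterval_convex {b c r : X} (hb : b ∈ cutInterval p q) (hc : c ∈ cutInterval p q)
    (hr : CutsBetween b r c) : r ∈ cutInterval p q :=
  ⟨CutsBetween.half_convex hb.1 hc.1 hr, CutsBetween.half_convex hb.2 hc.2 hr⟩

/-- If `p` and `q` are moved towards each other, there is a fixed point between them. -/
theorem exists_fixed_of_toward (hD : IsDendrite X) (hg : Continuous g)
    (hp : ¬ CutsBetween q p (g p)) (hq : ¬ CutsBetween p q (g q)) :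
    ∃ s ∈ cutInterval p q, g s = s := by
  by_contra! hfix
  have hpA : p ∈ cutInterval p q := segment_subset_cutInterval (CutsBetween.left _ _)
  have hqA : q ∈ cutInterval p q := segment_subset_cutInterval (CutsBetween.right _ _)
  have hA : IsCompact (cutInterval p q) :=
    ((hD.isClosed_half p q).inter (hD.isClosed_half q p)).isCompact
  let H : cutInterval p q → Set X := fun s => {t | t = s ∨ ¬ CutsBetween (g s) s t}
  have hmeet : ∀ s t : cutInterval p q, (cutInterval p q ∩ (H s ∩ H t)).Nonempty := by
    intro s t
    by_cases hs : (t : X) ∈ H s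
    · exact ⟨t, t.2, hs, Or.inl rfl⟩
    by_cases ht : (s : X) ∈ H t
    · exact ⟨s, s.2, Or.inl rfl, ht⟩
    exfalso
    obtain ⟨hts, hs⟩ : (t : X) ≠ s ∧ CutsBetween (g s) s t := by simpa [H] using hs
    obtain ⟨-, ht⟩ : (s : X) ≠ t ∧ CutsBetween (g t) t s := by simpa [H] using ht
    obtain ⟨r, hr, hgr⟩ := hD.exists_fixed_of_away hg hts.symm hs.symm ht.symm
    exact hfix r (cutInterval_convex s.2 t.2 hr) hgr
  obtain ⟨c, hcA, hc⟩ := hA.inter_iInter_nonempty H (fun s => hD.isClosed_half s (g s))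
    fun F => hD.helly H (fun i b hb c hc r hr => CutsBetween.half_convex hb hc hr)
      (fun i j => (hmeet i j).mono inter_subset_right) F _ ⟨p, hpA⟩
      (fun b hb c hc r hr => cutInterval_convex hb hc hr)
      (fun i _ => ⟨i, i.2, Or.inl rfl⟩)
  have hgc := hfix c hcA
  obtain ⟨e, heA, he⟩ : ∃ e ∈ cutInterval p q, ¬ CutsBetween (g c) c e := by
    by_cases h₁ : CutsBetween (g c) c p
    swap
    · exact ⟨p, hpA, h₁⟩
    by_cases h₂ : CutsBetween (g c) c q
    swap
    · exact ⟨q, hqA, h₂⟩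
    have hcp : c ≠ p := by
      rintro rfl
      exact hp h₂.symm
    have hcq : c ≠ q := by
      rintro rfl
      exact hq h₁.symm
    refine ⟨g c, ⟨Or.inr ?_, Or.inr ?_⟩, CutsBetween.not_refl hgc⟩
    · exact CutsBetween.not_trans (hcA.1.resolve_left hcp)
        fun h => hcp (CutsBetween.antisymm h₁.symm h).symm
    · exact CutsBetween.not_trans (hcA.2.resolve_left hcq)
        fun h => hcq (CutsBetween.antisymm h₂.symm h).symm
  have hN := (hD.isOpen_moved_toward hg (g c)).mem_nhds (CutsBetween.not_refl hgc)
  obtain ⟨t, htN, htc, hta, hte⟩ := hD.exists_common_between_near he hN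
  have htA : t ∈ cutInterval p q := cutInterval_convex hcA heA hte
  have hct : c = t ∨ ¬ CutsBetween (g t) t c := mem_iInter.1 hc ⟨t, htA⟩
  exact CutsBetween.not_trans htN (hct.resolve_left htc.symm) hta.symm

end FixedPoint

end IsDendrite

namespace IsDendrite

section Dynamics

variable {X : Type*} [TopologicalSpace X] [T2Space X] [CompactSpace X] [ConnectedSpace X]
  {f : X → X} {x u y : X}

/-- Each side of `x` contains a `u` for which `cutInterval x u` is as small as desired. -/
theorem exists_cutInterval_subset (hD : IsDendrite X) (hyx : y ≠ x) {U : Set X} (hU : U ∈ 𝓝 x) :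
    ∃ u, ¬ CutsBetween y x u ∧ cutInterval x u ⊆ U := by
  have hK : IsCompact ({s | s = x ∨ ¬ CutsBetween y x s} ∩ (interior U)ᶜ) :=
    ((hD.isClosed_half x y).inter isOpen_interior.isClosed_compl).isCompact
  obtain ⟨v, hv, hKv⟩ := hD.exists_between_compact hyx hK (by
    rintro k ⟨rfl | hk, hkU⟩
    · exact absurd (mem_interior_iff_mem_nhds.2 hU) hkU
    · exact hk)
  obtain ⟨u, huU, hux, huv⟩ := hD.exists_between_near (CutsBetween.ne_right hv).symm hU
  have hyu : ¬ CutsBetween y x u := CutsBetween.not_trans hv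
    fun h => hux (CutsBetween.antisymm huv h.symm).symm
  refine ⟨u, hyu, ?_⟩
  rintro s ⟨rfl | hs, hs'⟩
  · exact mem_of_mem_nhds hU
  rcases hs' with rfl | hs'
  · exact huU
  by_contra hsU
  exact hs' ((hKv s ⟨Or.inr (CutsBetween.not_trans hyu hs),
    fun h => hsU (interior_subset h)⟩).mono huv)

theorem cutInterval_subset_left {s : X} (hs : CutsBetween x s u) (hsu : s ≠ u) :
    cutInterval s u ⊆ cutInterval x u := by
  have hsx : ¬ CutsBetween x u s := (segment_subset_cutInterval hs).2.resolve_left hsu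
  rintro r ⟨hr₁, hr₂⟩
  refine ⟨?_, hr₂.imp_right (CutsBetween.not_trans hsx)⟩
  rcases hr₁ with rfl | hr₁
  · exact (segment_subset_cutInterval hs).1
  · exact Or.inr fun h => hr₁ (h.mono hs.symm)

theorem away_of_toward (hD : IsDendrite X) {g : X → X} (hg : Continuous g)
    (hfix : ∀ s ∈ cutInterval x u, g s ≠ s) {s : X} (hs : CutsBetween x s u) (hsu : s ≠ u)
    (hsg : ¬ CutsBetween u s (g s)) : CutsBetween x u (g u) := by
  by_contra h
  have hsx : ¬ CutsBetween x u s := (segment_subset_cutInterval hs).2.resolve_left hsu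
  obtain ⟨r, hr, hgr⟩ := hD.exists_fixed_of_toward hg hsg
    (CutsBetween.not_trans (CutsBetween.not_symm hsx) h)
  exact hfix r (cutInterval_subset_left hs hsu hr) hgr

theorem toward_of_away (hD : IsDendrite X) {g : X → X} (hg : Continuous g)
    (hfix : ∀ s ∈ cutInterval x u, g s ≠ s) {s : X} (hs : CutsBetween x s u) (hsu : s ≠ u)
    (hu : CutsBetween x u (g u)) : ¬ CutsBetween u s (g s) := by
  intro h
  have hsx : ¬ CutsBetween x u s := (segment_subset_cutInterval hs).2.resolve_left hsu
  obtain ⟨r, hr, hgr⟩ := hD.exists_fixed_of_away hg hsu h (hu.of_not_left hsx)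
  exact hfix r (segment_subset_cutInterval (hs.left_trans hr)) hgr

/-- If no periodic point lies in `cutInterval x u` and `f^[n]` moves `x` into it, then all
iterates of `f^[n]` move `x` to the side of `u`. -/
theorem iterate_toward (hD : IsDendrite X) (hf : Continuous f)
    (hper : ∀ s ∈ cutInterval x u, ¬ IsPeriodic f s) {n : ℕ} (hn : 1 ≤ n)
    (hx : ¬ CutsBetween u x (f^[n] x)) (hu : ¬ CutsBetween x u (f^[n] x)) (k : ℕ) :
    ¬ CutsBetween u x (f^[(k + 1) * n] x) := by
  have hcont : ∀ j, Continuous f^[j] := fun j => hf.iterate j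
  have hfix : ∀ j, 1 ≤ j → ∀ s ∈ cutInterval x u, f^[j] s ≠ s :=
    fun j hj s hs h => hper s hs ⟨j, hj, h⟩
  have hxu : x ≠ u := (CutsBetween.ne_left hx).symm
  have hxx : CutsBetween x x u := CutsBetween.left _ _
  obtain ⟨z, hxzu, huzy, hyzx⟩ := hD.exists_median x u (f^[n] x)
  have hzu : z ≠ u := by
    rintro rfl
    exact hu hyzx.symm
  have hgz := hD.toward_of_away (hcont n) (hfix n hn) hxzu hzu
    (hD.away_of_toward (hcont n) (hfix n hn) hxx hxu hx)
  obtain ⟨w, hxwz, hw⟩ : ∃ w, CutsBetween x w z ∧ f^[n] w = z := by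
    have hB : IsCompact ({s | CutsBetween x s z} ∩
        f^[n] ⁻¹' {t | t = z ∨ ¬ CutsBetween u z t}) :=
      ((hD.isClosed_segment x z).inter ((hD.isClosed_half z u).preimage (hcont n))).isCompact
    obtain ⟨w, ⟨hw, hgw⟩, hmin⟩ := hD.exists_first x hB ⟨z, CutsBetween.right _ _, Or.inr hgz⟩
    refine ⟨w, hw, hgw.resolve_right fun hgw => ?_⟩
    have hwx : w ≠ x := by
      rintro rfl
      exact hgw huzy
    obtain ⟨t, htN, htw, ht⟩ := hD.exists_between_near hwx
      (((hD.isOpen_side z u).preimage (hcont n)).mem_nhds hgw)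
    exact htw (hmin t ⟨CutsBetween.mono hw ht.symm, Or.inr htN⟩ ht.symm)
  have hwz : w ≠ z := by
    rintro rfl
    exact hfix n hn w (segment_subset_cutInterval hxzu) hw
  have hxwu : CutsBetween x w u := hxzu.mono hxwz
  have hwzu : CutsBetween w z u := hxzu.mono_right hxwz
  have hwu : w ≠ u := by
    rintro rfl
    exact hwz (CutsBetween.eq_of_refl hwzu).symm
  induction k with
  | zero => simpa using hx
  | succ k ih =>
    have hk : ∀ k, 1 ≤ (k + 1) * n := fun k => Nat.mul_pos k.succ_pos hn
    have hhz := hD.toward_of_away (hcont _) (hfix _ (hk k)) hxzu hzu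
      (hD.away_of_toward (hcont _) (hfix _ (hk k)) hxx hxu ih)
    rw [← hw, ← Function.iterate_add_apply, hw, show (k + 1) * n + n = (k + 1 + 1) * n by ring]
      at hhz
    refine hD.toward_of_away (hcont _) (hfix _ (hk (k + 1))) hxx hxu
      (hD.away_of_toward (hcont _) (hfix _ (hk (k + 1))) hxwu hwu fun h => ?_)
    have h₁ : CutsBetween w z (f^[(k + 1 + 1) * n] w) := hwzu.of_not_right hhz
    exact CutsBetween.not_trans (b := z)
      (fun h' => hwz (CutsBetween.antisymm hwzu h'.symm))
      (fun h' => hwz (CutsBetween.antisymm h₁ h')) h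

theorem exists_iterate_toward (hD : IsDendrite X) (hf : Continuous f)
    (hdense : HasDenseOrbit f x) {U : Set X} (hU : U ∈ 𝓝 x) (hper : ∀ s ∈ U, ¬ IsPeriodic f s)
    (hyx : y ≠ x) : ∃ n, 1 ≤ n ∧ ∀ k, ¬ CutsBetween y x (f^[(k + 1) * n] x) := by
  obtain ⟨u, hyu, huU⟩ := hD.exists_cutInterval_subset hyx hU
  obtain ⟨v, hvx, hvu, hv⟩ := hD.exists_between (CutsBetween.ne_right hyu).symm
  obtain ⟨-, ⟨hn₁, hn₂⟩, n, hn, rfl⟩ := hdense.inter_open_nonempty _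
    ((hD.isOpen_side x u).inter (hD.isOpen_side u x))
    ⟨v, fun h => hvx (CutsBetween.eq_of_refl (hv.symm.mono_right h)),
      fun h => hvu (CutsBetween.eq_of_refl (hv.mono_right h))⟩
  exact ⟨n, hn, fun k => CutsBetween.not_trans hyu
    (hD.iterate_toward hf (fun s hs => hper s (huU hs)) hn hn₁ hn₂ k)⟩

end Dynamics

end IsDendrite

theorem exists_cutsBetween_of_not_isEndpointOf {X : Type*} [TopologicalSpace X] {x : X}
    (hx : ¬ IsEndpointOf X x) : ∃ a b, a ≠ x ∧ b ≠ x ∧ CutsBetween a x b := by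
  by_contra! h
  refine hx (isPreconnected_of_forall_pair fun a ha b hb => ?_)
  exact ⟨_, connectedComponentIn_subset _ _, mem_connectedComponentIn ha,
    not_not.1 (h a b ha hb), isPreconnected_connectedComponentIn⟩

theorem IsPeriodic.iterate {X : Type*} {f : X → X} {p : X} (hp : IsPeriodic f p) (k : ℕ) :
    IsPeriodic f (f^[k] p) := by
  obtain ⟨n, hn, h⟩ := hp
  exact ⟨n, hn, by rw [← Function.iterate_add_apply, add_comm, Function.iterate_add_apply, h]⟩

/-- If some non-endpoint of a dendrite has dense orbit, then the periodic
points are dense. -/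
theorem stmt4 {D : Type*} [MetricSpace D] [CompactSpace D] [ConnectedSpace D]
    (hD : IsDendrite D) {f : D → D} (hf : Continuous f)
    {x : D} (hx : ¬ IsEndpointOf D x) (hdense : HasDenseOrbit f x) :
    Dense {p : D | IsPeriodic f p} := by
  have hcl : x ∈ closure {p : D | IsPeriodic f p} := by
    by_contra hcl
    have hU : {p : D | ¬ IsPeriodic f p} ∈ 𝓝 x := by
      have := isClosed_closure.isOpen_compl.mem_nhds hcl
      exact mem_of_superset this fun p hp h => hp (subset_closure h)
    obtain ⟨a, b, ha, hb, hab⟩ := exists_cutsBetween_of_not_isEndpointOf hx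
    obtain ⟨m, hm, ham⟩ := hD.exists_iterate_toward hf hdense hU (fun s hs => hs) ha
    obtain ⟨n, hn, hbn⟩ := hD.exists_iterate_toward hf hdense hU (fun s hs => hs) hb
    have h₁ := ham (n - 1)
    have h₂ := hbn (m - 1)
    rw [Nat.sub_add_cancel hn] at h₁
    rw [Nat.sub_add_cancel hm, mul_comm] at h₂
    exact CutsBetween.not_trans h₁ (CutsBetween.not_symm h₂) hab
  refine dense_closure.1 (hdense.mono ?_)
  rintro _ ⟨k, -, rfl⟩
  exact map_mem_closure (hf.iterate k) hcl fun p hp => hp.iterate k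
end

section
/- Let D be a dendrite and f : D → D a continuous transitive map such that the set Per(f) of periodic points of f is not dense in D. Then every point x ∈ D whose orbit under f is dense in D is an endpoint of D. -/
open Set Topology Filter TopologicalSpace

theorem IsPeriodic.of_iterate {X : Type*} {f : X → X} {a : X} {n : ℕ} (hn : 1 ≤ n) (h : IsPeriodic (f^[n]) a) :
    IsPeriodic f a := by
  obtain ⟨k, hk, h⟩ := h
  exact ⟨n * k, Nat.mul_pos hn hk, by rwa [Function.iterate_mul]⟩

/-- The component of `X \ {z}` containing `y`, empty if `y = z`. -/
def side {X : Type*} [TopologicalSpace X] (z y : X) : Set X :=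
  connectedComponentIn ({z}ᶜ : Set X) y

/-- The arc from `x` to `y`: the points that do not leave `x` and `y` on the same side. -/
def arc {X : Type*} [TopologicalSpace X] (x y : X) : Set X :=
  {q | y ∉ side q x}

section Side

variable {X : Type*} [TopologicalSpace X] {a b c p q x y z : X} {K : Set X}

theorem notMem_side_self : z ∉ side z y :=
  fun h => connectedComponentIn_subset _ _ h rfl

theorem side_self : side z z = ∅ :=
  connectedComponentIn_eq_empty (by simp)

theorem mem_side (h : y ≠ z) : y ∈ side z y :=
  mem_connectedComponentIn h

theorem ne_of_mem_side (h : a ∈ side z y) : a ≠ z := by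
  rintro rfl
  exact notMem_side_self h

theorem base_ne_of_mem_side (h : a ∈ side z y) : y ≠ z := by
  rintro rfl
  simp [side_self] at h

theorem isPreconnected_side : IsPreconnected (side z y) :=
  isPreconnected_connectedComponentIn

theorem side_eq (h : a ∈ side z y) : side z y = side z a :=
  connectedComponentIn_eq h

theorem mem_side_comm : a ∈ side z y ↔ y ∈ side z a := by
  constructor <;> intro h <;> rw [← side_eq h] <;> exact mem_side (base_ne_of_mem_side h)

theorem IsPreconnected.subset_side (hK : IsPreconnected K) (hz : z ∉ K) (ha : a ∈ K)
    (hay : a ∈ side z y) : K ⊆ side z y := by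
  rw [side_eq hay]
  exact hK.subset_connectedComponentIn ha (subset_compl_singleton_iff.2 hz)

theorem IsPreconnected.mem_side (hK : IsPreconnected K) (hz : z ∉ K) (ha : a ∈ K) (hb : b ∈ K) :
    b ∈ side z a :=
  hK.subset_connectedComponentIn ha (subset_compl_singleton_iff.2 hz) hb

theorem closure_side_subset : closure (side z y) ⊆ insert z (side z y) := by
  intro b hb
  by_contra hn
  rw [mem_insert_iff, not_or] at hn
  rcases (side z y).eq_empty_or_nonempty with h | ⟨a, ha⟩
  · simp [h] at hb
  · have h : IsPreconnected (insert b (side z y)) :=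
      isPreconnected_side.subset_closure (subset_insert _ _)
        (insert_subset hb subset_closure)
    exact hn.2 (h.subset_side
      (by rw [mem_insert_iff, not_or]; exact ⟨Ne.symm hn.1, notMem_side_self⟩)
      (mem_insert_of_mem _ ha) ha (mem_insert _ _))

theorem mem_arc_comm : q ∈ arc x y ↔ q ∈ arc y x :=
  not_congr mem_side_comm

theorem left_mem_arc : x ∈ arc x y := by
  simp [arc, side_self]

theorem right_mem_arc : y ∈ arc x y :=
  notMem_side_self

theorem side_subset_side_of_mem_arc (hq : q ∈ arc x b) : side q x ⊆ side b x := by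
  intro a ha
  exact isPreconnected_side.mem_side hq (mem_side (base_ne_of_mem_side ha)) ha

theorem arc_subset_arc (hq : q ∈ arc x b) : arc x q ⊆ arc x b := fun _ ht hb =>
  hq (isPreconnected_side.mem_side ht (mem_side (base_ne_of_mem_side hb)) hb)

theorem IsDendrite.exists_notMem_side (hD : IsDendrite X) (h : x ≠ y) :
    ∃ z, z ≠ x ∧ z ≠ y ∧ y ∉ side z x := by
  obtain ⟨z, hx, hy, hz⟩ := hD.2 x y h
  exact ⟨z, hx, hy, fun h' => hz (side_eq h')⟩

theorem isClosed_insert_side [T1Space X] : IsClosed (insert z (side z y)) := by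
  rw [← closure_subset_iff_isClosed, insert_eq, closure_union, closure_singleton]
  exact union_subset subset_union_left closure_side_subset

end Side

section Dendrite

variable {X : Type*} [TopologicalSpace X] [CompactSpace X] [T2Space X] [ConnectedSpace X]
  {a b c p q r x y z : X} {K : Set X}

theorem mem_closure_side (h : y ≠ z) : z ∈ closure (side z y) := by
  by_contra hz
  have hcl : IsClosed (side z y) := by
    rw [← closure_subset_iff_isClosed]
    intro a ha
    rcases closure_side_subset ha with rfl | h'
    · exact absurd ha hz
    · exact h'
  obtain ⟨O, V, hO, hV, hCO, hzV, hOV⟩ :=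
    normal_separation hcl (isClosed_singleton (x := z))
      (disjoint_singleton_right.2 notMem_side_self)
  have hOz : closure O ⊆ {z}ᶜ := by
    intro a ha haz
    rw [mem_singleton_iff] at haz
    subst haz
    exact (hOV.closure_left hV).le_bot ⟨ha, hzV rfl⟩
  have hyO : y ∈ closure O := subset_closure (hCO (mem_side h))
  have : CompactSpace (closure O) := isCompact_iff_compactSpace.1 isClosed_closure.isCompact
  have hcomp : ((↑) : closure O → X) '' connectedComponent (⟨y, hyO⟩ : closure O) ⊆ side z y := by
    rw [← connectedComponentIn_eq_image hyO]
    exact connectedComponentIn_mono _ hOz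
  rw [connectedComponent_eq_iInter_isClopen] at hcomp
  have hO' : IsOpen (((↑) : closure O → X) ⁻¹' O) := hO.preimage continuous_subtype_val
  have : Nonempty { s : Set (closure O) // IsClopen s ∧ (⟨y, hyO⟩ : closure O) ∈ s } :=
    ⟨⟨univ, isClopen_univ, mem_univ _⟩⟩
  obtain ⟨⟨Q, hQ, hyQ⟩, hQO⟩ := exists_subset_nhds_of_isCompact'
    (V := fun s : { s : Set (closure O) // IsClopen s ∧ (⟨y, hyO⟩ : closure O) ∈ s } =>
      (s : Set (closure O)))
    (by
      rintro ⟨s, hs, hys⟩ ⟨t, ht, hyt⟩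
      exact ⟨⟨s ∩ t, hs.inter ht, hys, hyt⟩, inter_subset_left, inter_subset_right⟩)
    (fun s => s.2.1.isClosed.isCompact) (fun s => s.2.1.isClosed)
    (U := ((↑) : closure O → X) ⁻¹' O)
    (fun a ha => hO'.mem_nhds (hCO (hcomp ⟨a, ha, rfl⟩)))
  have hQclosed : IsClosed (((↑) : closure O → X) '' Q) :=
    (hQ.isClosed.isCompact.image continuous_subtype_val).isClosed
  have hQopen : IsOpen (((↑) : closure O → X) '' Q) := by
    obtain ⟨T, hT, rfl⟩ := isOpen_induced_iff.1 hQ.isOpen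
    have : ((↑) : closure O → X) '' (((↑) : closure O → X) ⁻¹' T) = T ∩ O := by
      ext a
      constructor
      · rintro ⟨a, ha, rfl⟩
        exact ⟨ha, hQO ha⟩
      · rintro ⟨haT, haO⟩
        exact ⟨⟨a, subset_closure haO⟩, haT, rfl⟩
    rw [this]
    exact hT.inter hO
  rcases isClopen_iff.1 ⟨hQclosed, hQopen⟩ with h0 | h1
  · have : y ∈ ((↑) : closure O → X) '' Q := ⟨_, hyQ, rfl⟩
    simp [h0] at this
  · have : z ∈ ((↑) : closure O → X) '' Q := by rw [h1]; trivial
    obtain ⟨w, -, hw⟩ := this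
    exact hOz w.2 hw

theorem isPreconnected_insert_side : IsPreconnected (insert z (side z y)) := by
  rcases eq_or_ne y z with rfl | h
  · simpa [side_self] using isPreconnected_singleton
  · exact isPreconnected_side.subset_closure (subset_insert _ _)
      (insert_subset (mem_closure_side h) subset_closure)

/-- A point with any family of sides at it is connected. -/
theorem isPreconnected_sides {S : Set X} (hz : z ∈ S) (hS : ∀ a ∈ S, a ≠ z → side z a ⊆ S) :
    IsPreconnected S := by
  refine isPreconnected_of_forall z fun a ha => ?_
  rcases eq_or_ne a z with rfl | h
  · exact ⟨{a}, by simpa using ha, rfl, rfl, isPreconnected_singleton⟩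
  · exact ⟨insert z (side z a), insert_subset hz (hS a ha h), mem_insert _ _,
      mem_insert_of_mem _ (mem_side h), isPreconnected_insert_side⟩

theorem isPreconnected_compl_side : IsPreconnected (side z y)ᶜ := by
  refine isPreconnected_sides (z := z) notMem_side_self fun a ha _ b hb hby => ha ?_
  rw [side_eq hby, ← side_eq hb]
  exact mem_side (base_ne_of_mem_side hb)

theorem mem_side_of_notMem_side (ha : a ∉ side z y) (hb : b ∉ side z y) (hq : q ∈ side z y) :
    b ∈ side q a :=
  isPreconnected_compl_side.mem_side (not_not_intro hq) ha hb

theorem IsDendrite.isOpen_side_s5 (hD : IsDendrite X) : IsOpen (side z y) := by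
  by_contra hopen
  rw [isOpen_iff_mem_nhds] at hopen
  push Not at hopen
  obtain ⟨p, hp, hpn⟩ := hopen
  obtain ⟨q, hqp, hqz, hq⟩ := hD.exists_notMem_side (ne_of_mem_side hp)
  set S : Set X := {a | a ∉ side z y ∧ a ∉ side z q} with hS
  have hSz : IsPreconnected S := by
    refine isPreconnected_sides (z := z) ⟨notMem_side_self, notMem_side_self⟩ ?_
    rintro a ⟨ha, ha'⟩ haz b hb
    have hab : a ∈ side z b := mem_side_comm.1 hb
    exact ⟨fun h => ha (side_eq h ▸ hab), fun h => ha' (side_eq h ▸ hab)⟩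
  have hpS : p ∈ closure S := by
    have h1 : p ∈ closure (side z y)ᶜ := by
      rw [closure_compl]
      exact fun h => hpn (mem_interior_iff_mem_nhds.1 h)
    by_cases hqy : q ∈ side z y
    · have : S = (side z y)ᶜ := by
        ext a
        simp only [hS, mem_ofPred_eq, mem_compl_iff, ← side_eq hqy, and_self]
      rwa [this]
    · have h2 : (side z y)ᶜ ⊆ S ∪ side z q := fun a ha => by
        by_cases h : a ∈ side z q
        · exact Or.inr h
        · exact Or.inl ⟨ha, h⟩
      have h3 := closure_mono h2 h1
      rw [closure_union] at h3
      rcases h3 with h3 | h3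
      · exact h3
      · rcases closure_side_subset h3 with h4 | h4
        · exact absurd h4 (ne_of_mem_side hp)
        · refine absurd ?_ hqy
          rw [side_eq hp, ← mem_side_comm]
          exact h4
  have hcon : IsPreconnected (insert p S) :=
    hSz.subset_closure (subset_insert _ _) (insert_subset hpS subset_closure)
  refine hq (hcon.mem_side ?_ (mem_insert _ _) (mem_insert_of_mem _ ?_))
  · rw [mem_insert_iff, not_or]
    exact ⟨hqp, fun h => h.2 (mem_side hqz)⟩
  · exact ⟨notMem_side_self, notMem_side_self⟩

theorem arc_antisymm (hq : q ∈ arc p r) (hr : r ∈ arc p q) : q = r := by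
  by_contra hne
  rcases eq_or_ne p q with rfl | hp
  · exact hr (mem_side hne)
  · rcases closure_side_subset (closure_mono (side_subset_side_of_mem_arc hq)
      (mem_closure_side hp)) with h | h
    · exact hne h
    · exact hr h

theorem notMem_insert_side_of_mem_arc (hq : q ∈ arc p r) (hc : c ∉ insert r (side r p)) :
    c ∉ insert q (side q p) := by
  intro hcq
  rw [mem_insert_iff, not_or] at hc
  rcases hcq with rfl | hcq
  · exact hc.1 (arc_antisymm hq hc.2)
  · exact hc.2 (side_subset_side_of_mem_arc hq hcq)

theorem arc_total (hp : p ∈ arc x y) (hq : q ∈ arc x y) : p ∈ arc x q ∨ q ∈ arc x p := by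
  by_contra! h
  obtain ⟨h1, h2⟩ := h
  have h1 : q ∈ side p x := not_not.1 h1
  have h2 : p ∈ side q x := not_not.1 h2
  refine hq ?_
  rw [side_eq h2]
  exact mem_side_of_notMem_side notMem_side_self hp h1

/-- The sets of points lying strictly behind some `q`, as seen from `p`, are directed on each
side of `p`. -/
theorem IsDendrite.exists_behind (hD : IsDendrite X) (hb : b ∈ side p a) :
    ∃ q, q ≠ p ∧ a ∉ insert q (side q p) ∧ b ∉ insert q (side q p) := by
  set O : X → Set X := fun a =>
    {b | ∃ q, q ≠ p ∧ a ∉ insert q (side q p) ∧ b ∉ insert q (side q p)} with hO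
  have hopen : ∀ a, IsOpen (O a) := by
    intro a
    rw [isOpen_iff_mem_nhds]
    rintro b ⟨q, hq, ha, hb⟩
    filter_upwards [isClosed_insert_side.isOpen_compl.mem_nhds hb] with c hc
    exact ⟨q, hq, ha, hc⟩
  have hrefl : ∀ a, a ≠ p → a ∈ O a := by
    intro a ha
    obtain ⟨q, hqp, hqa, h⟩ := hD.exists_notMem_side ha.symm
    have : a ∉ insert q (side q p) := by
      rw [mem_insert_iff, not_or]
      exact ⟨hqa.symm, h⟩
    exact ⟨q, hqp, this, this⟩
  have htrans : ∀ a b c, b ∈ O a → c ∈ O b → c ∈ O a := by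
    rintro a b c ⟨q, hq, ha, hb⟩ ⟨r, hr, hb', hc⟩
    have hbq : q ∈ arc p b := fun h => hb (mem_insert_of_mem _ h)
    have hbr : r ∈ arc p b := fun h => hb' (mem_insert_of_mem _ h)
    rcases arc_total hbq hbr with h | h
    · exact ⟨q, hq, ha, notMem_insert_side_of_mem_arc h hc⟩
    · exact ⟨r, hr, notMem_insert_side_of_mem_arc h ha, hc⟩
  have hsymm : ∀ a b, b ∈ O a → a ∈ O b := by
    rintro a b ⟨q, hq, ha, hb⟩
    exact ⟨q, hq, hb, ha⟩
  have hap : a ≠ p := base_ne_of_mem_side hb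
  refine isPreconnected_side.subset_left_of_subset_union (hopen a)
    (isOpen_biUnion fun b (_ : b ∈ (O a)ᶜ) => hopen b) ?_ ?_ ⟨a, mem_side hap, hrefl a hap⟩ hb
  · rw [Set.disjoint_left]
    intro c hca hcb
    simp only [mem_iUnion] at hcb
    obtain ⟨b, hb, hcb⟩ := hcb
    exact hb (htrans _ _ _ hca (hsymm _ _ hcb))
  · intro b hb
    by_cases h : b ∈ O a
    · exact Or.inl h
    · exact Or.inr (mem_biUnion h (hrefl b (ne_of_mem_side hb)))

/-- A point `q` off the arc from `x` to `y` lies on a side that avoids this arc. -/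
theorem IsDendrite.exists_side_of_notMem_arc (hD : IsDendrite X) (hq : q ∉ arc x y) :
    ∃ r, q ∈ side r q ∧ x ∉ side r q ∧ y ∉ side r q := by
  have hq : y ∈ side q x := not_not.1 hq
  obtain ⟨r, hr, hx, hy⟩ := hD.exists_behind hq
  exact ⟨r, mem_side hr.symm, fun h => hx (mem_insert_of_mem _ h),
    fun h => hy (mem_insert_of_mem _ h)⟩

theorem arc_eq_iInter (hD : IsDendrite X) (x y : X) :
    arc x y = ⋂ s : {s : X × X // x ∉ side s.1 s.2 ∧ y ∉ side s.1 s.2}, (side s.1.1 s.1.2)ᶜ := by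
  ext q
  rw [mem_iInter]
  constructor
  · rintro hq ⟨⟨r, s⟩, hx, hy⟩ h
    exact hq (mem_side_of_notMem_side hx hy h)
  · intro h
    by_contra hq
    obtain ⟨r, hqr, hx, hy⟩ := hD.exists_side_of_notMem_arc hq
    exact h ⟨(r, q), hx, hy⟩ hqr

theorem IsDendrite.isClosed_arc (hD : IsDendrite X) : IsClosed (arc x y) := by
  rw [arc_eq_iInter hD]
  exact isClosed_iInter fun _ => hD.isOpen_side_s5.isClosed_compl

open Classical in
/-- Collapsing a side onto its base point is continuous. -/
theorem IsDendrite.continuous_collapse (hD : IsDendrite X) :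
    Continuous fun a => if a ∈ side z y then z else a := by
  refine Continuous.if (p := fun a => a ∈ side z y) ?_ continuous_const continuous_id
  intro a ha
  have h : a ∈ closure (side z y) \ side z y := by
    have := hD.isOpen_side_s5 (z := z) (y := y)
    rwa [← this.frontier_eq]
  rcases closure_side_subset h.1 with h1 | h1
  · exact h1.symm
  · exact absurd h1 h.2

open Classical in
/-- Collapsing the complement of a side onto its base point is continuous. -/
theorem IsDendrite.continuous_collapse_compl (hD : IsDendrite X) :
    Continuous fun a => if a ∈ side z y then a else z := by
  refine Continuous.if (p := fun a => a ∈ side z y) ?_ continuous_id continuous_const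
  intro a ha
  have h : a ∈ closure (side z y) \ side z y := by
    have := hD.isOpen_side_s5 (z := z) (y := y)
    rwa [← this.frontier_eq]
  rcases closure_side_subset h.1 with h1 | h1
  · exact h1
  · exact absurd h1 h.2

theorem IsDendrite.isPreconnected_diff_side (hD : IsDendrite X) (hK : IsPreconnected K) :
    IsPreconnected (K \ side z y) := by
  classical
  by_cases hz : z ∈ K
  · convert hK.image _ (hD.continuous_collapse (z := z) (y := y)).continuousOn using 1
    ext a
    constructor
    · rintro ⟨ha, ha'⟩
      exact ⟨a, ha, by simp [ha']⟩
    · rintro ⟨b, hb, rfl⟩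
      by_cases h : b ∈ side z y
      · simp [h, hz, notMem_side_self]
      · simp [h, hb]
  · by_cases h : ∃ a ∈ K, a ∈ side z y
    · obtain ⟨a, ha, hay⟩ := h
      rw [sdiff_eq_empty.2 (hK.subset_side hz ha hay)]
      exact isPreconnected_empty
    · push Not at h
      have : K \ side z y = K := by
        rw [sdiff_eq_left]
        exact Set.disjoint_left.2 h
      rwa [this]

theorem isPreconnected_iInter_of_directed {Y ι : Type*} [TopologicalSpace Y] [CompactSpace Y]
    [T2Space Y] [Nonempty ι] {V : ι → Set Y} (hdir : Directed (· ⊇ ·) V)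
    (hcl : ∀ i, IsClosed (V i)) (hV : ∀ i, IsPreconnected (V i)) :
    IsPreconnected (⋂ i, V i) := by
  rw [isPreconnected_iff_subset_of_fully_disjoint_closed (isClosed_iInter hcl)]
  intro u v hu hv huv hd
  obtain ⟨U, W, hU, hW, huU, hvW, hUW⟩ := normal_separation hu hv hd
  obtain ⟨i, hi⟩ := exists_subset_nhds_of_isCompact' hdir (fun i => (hcl i).isCompact) hcl
    (U := U ∪ W) fun a ha => (hU.union hW).mem_nhds (union_subset_union huU hvW (huv ha))
  rcases (hV i).subset_or_subset hU hW hUW hi with h | h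
  · refine Or.inl fun a ha => (huv ha).resolve_right fun hav => ?_
    exact hUW.le_bot ⟨h (mem_iInter.1 ha i), hvW hav⟩
  · refine Or.inr fun a ha => (huv ha).resolve_left fun hau => ?_
    exact hUW.le_bot ⟨huU hau, h (mem_iInter.1 ha i)⟩

theorem IsDendrite.isPreconnected_arc (hD : IsDendrite X) : IsPreconnected (arc x y) := by
  classical
  set ι := {s : X × X // x ∉ side s.1 s.2 ∧ y ∉ side s.1 s.2}
  have h : arc x y = ⋂ F : Finset ι, ⋂ s ∈ F, (side s.1.1 s.1.2)ᶜ := by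
    rw [arc_eq_iInter hD, ← iInter_eq_iInter_finset]
  rw [h]
  refine isPreconnected_iInter_of_directed ?_ ?_ ?_
  · intro F G
    exact ⟨F ∪ G, biInter_subset_biInter_left fun s hs => Finset.mem_union_left _ hs,
      biInter_subset_biInter_left fun s hs => Finset.mem_union_right _ hs⟩
  · exact fun F => isClosed_biInter fun _ _ => hD.isOpen_side_s5.isClosed_compl
  · intro F
    induction F using Finset.induction with
    | empty => simpa using isPreconnected_univ
    | insert s F _ ih =>
      rw [Finset.set_biInter_insert, inter_comm, ← sdiff_eq]
      exact hD.isPreconnected_diff_side ih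

theorem mem_side_of_mem_arc (hq : q ∈ arc x y) (hne : q ≠ x) : q ∈ side x y :=
  mem_side_of_notMem_side hq notMem_side_self (mem_side hne.symm)

theorem IsDendrite.exists_mem_arc_of_mem_nhds (hD : IsDendrite X) (hxy : x ≠ y) {N : Set X}
    (hN : N ∈ 𝓝 x) : ∃ q ∈ arc x y, q ∈ N ∧ q ≠ x := by
  obtain ⟨U, hUN, hU, hxU⟩ := mem_nhds_iff.1 hN
  obtain ⟨q, hq, hqU, hqx⟩ := hD.isPreconnected_arc (x := x) (y := y) U {x}ᶜ hU
    isOpen_compl_singleton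
    (fun a _ => by
      rcases eq_or_ne a x with rfl | h
      · exact Or.inl hxU
      · exact Or.inr h)
    ⟨x, left_mem_arc, hxU⟩ ⟨y, right_mem_arc, hxy.symm⟩
  exact ⟨q, hq, hUN hqU, hqx⟩

theorem IsDendrite.exists_median_s5 (hD : IsDendrite X) (x y z : X) :
    ∃ c ∈ arc x y, c ∈ arc x z ∧ c ∈ arc y z := by
  refine isPreconnected_closed_iff.1 (hD.isPreconnected_arc (x := x) (y := y)) (arc x z)
    (arc y z) hD.isClosed_arc hD.isClosed_arc ?_ ⟨x, left_mem_arc, left_mem_arc⟩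
    ⟨y, right_mem_arc, left_mem_arc⟩
  intro q hq
  by_contra! h
  rw [mem_union, not_or] at h
  have h1 : z ∈ side q x := not_not.1 h.1
  have h2 : z ∈ side q y := not_not.1 h.2
  refine hq ?_
  rw [side_eq h1, ← mem_side_comm]
  exact h2

/-- Dendrites have the fixed point property. -/
theorem IsDendrite.exists_fixedPoint_s5 (hD : IsDendrite X) {φ : X → X} (hφ : Continuous φ) :
    ∃ p, φ p = p := by
  by_contra! hfix
  obtain ⟨x₀⟩ : Nonempty X := inferInstance
  have hpt : ∀ p, φ p ∈ side p (φ p) := fun p => mem_side (hfix p)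
  obtain ⟨m, -, hm⟩ := zorn_superset_nonempty (range fun p => side p (φ p)) (by
    intro c hc hchain hne
    have : Nonempty c := hne.to_subtype
    set P : c → Set X := fun S => closure {p | side p (φ p) ∈ c ∧ side p (φ p) ⊆ S}
    obtain ⟨p, hp⟩ : (⋂ S, P S).Nonempty := by
      refine IsCompact.nonempty_iInter_of_directed_nonempty_isCompact_isClosed P ?_ ?_
        (fun _ => isClosed_closure.isCompact) (fun _ => isClosed_closure)
      · intro S T
        rcases hchain.total S.2 T.2 with h | h
        · exact ⟨S, Subset.rfl, closure_mono fun p hp => ⟨hp.1, hp.2.trans h⟩⟩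
        · exact ⟨T, closure_mono fun p hp => ⟨hp.1, hp.2.trans h⟩, Subset.rfl⟩
      · rintro ⟨S, hS⟩
        obtain ⟨p, rfl⟩ := hc hS
        exact ⟨p, subset_closure ⟨hS, Subset.rfl⟩⟩
    refine ⟨side p (φ p), ⟨p, rfl⟩, fun S hS => ?_⟩
    have hnear : ∀ N ∈ 𝓝 p, ∃ p' ∈ N, side p' (φ p') ⊆ S := by
      intro N hN
      obtain ⟨p', hp', -, h⟩ := mem_closure_iff_nhds.1 (mem_iInter.1 hp ⟨S, hS⟩) N hN
      exact ⟨p', hp', h⟩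
    obtain ⟨s, rfl⟩ := hc hS
    have hs : s ∉ side p (φ p) := by
      intro hs
      obtain ⟨q, hqp, h1, h2⟩ := hD.exists_behind hs
      obtain ⟨p', ⟨hp', hp''⟩, hsub⟩ := hnear (side q p ∩ φ ⁻¹' (insert q (side q p))ᶜ)
        (inter_mem (hD.isOpen_side_s5.mem_nhds (mem_side hqp.symm))
          ((isClosed_insert_side.isOpen_compl.preimage hφ).mem_nhds h1))
      exact notMem_side_self (hsub (mem_side_of_notMem_side
        (fun h => hp'' (mem_insert_of_mem _ h)) (fun h => h2 (mem_insert_of_mem _ h)) hp'))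
    obtain ⟨p', hp', hsub⟩ := hnear (φ ⁻¹' side p (φ p))
      ((hD.isOpen_side_s5.preimage hφ).mem_nhds (hpt p))
    exact isPreconnected_side.subset_side hs hp' (hsub (hpt p'))) _ ⟨x₀, rfl⟩
  obtain ⟨⟨p, rfl⟩, hmin⟩ := hm
  obtain ⟨r, hrp, hrφ, hr⟩ := hD.exists_notMem_side (hfix p).symm
  obtain ⟨q, hq, hqN, hqp⟩ := hD.exists_mem_arc_of_mem_nhds hrp.symm
    (N := φ ⁻¹' (insert r (side r p))ᶜ)
    ((isClosed_insert_side.isOpen_compl.preimage hφ).mem_nhds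
      (by simpa [not_or] using ⟨hrφ.symm, hr⟩))
  have hqN : φ q ∉ side r p := fun h => hqN (mem_insert_of_mem _ h)
  have hpr : p ∈ side r p := mem_side hrp.symm
  have heq : side p (φ p) = side p r :=
    (side_eq (mem_side_of_notMem_side notMem_side_self hr hpr)).symm
  have hsub : side q (φ q) ⊆ side p (φ p) := by
    rw [heq]
    refine isPreconnected_side.subset_side ?_ (hpt q)
      (mem_side_of_notMem_side notMem_side_self hqN hpr)
    rw [mem_side_comm]
    exact fun h => hqN (side_subset_side_of_mem_arc hq h)
  have hqm : q ∈ side p (φ p) := by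
    rw [heq]
    exact mem_side_of_mem_arc hq hqp
  exact notMem_side_self (hmin ⟨q, rfl⟩ hsub hqm)

/-- If a base point is mapped into one of its sides, then that side contains a fixed point. -/
theorem IsDendrite.exists_fixedPoint_side (hD : IsDendrite X) {h : X → X} (hh : Continuous h)
    (hz : h z ∈ side z y) : ∃ p ∈ side z y, h p = p := by
  classical
  obtain ⟨p, hp⟩ := hD.exists_fixedPoint_s5
    ((hD.continuous_collapse_compl (z := z) (y := y)).comp hh)
  simp only [Function.comp_apply] at hp
  split_ifs at hp with h1
  · exact ⟨p, hp ▸ h1, hp⟩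
  · exact absurd hz (hp ▸ h1)

/-- If `h` moves `x` and `y` towards each other, there is a fixed point between them. -/
theorem IsDendrite.exists_fixedPoint_between (hD : IsDendrite X) {h : X → X} (hh : Continuous h)
    (hx : h x ∈ side x y) (hy : h y ∈ side y x) :
    ∃ p ∈ side x y ∩ side y x, h p = p := by
  classical
  have hxy : x ≠ y := base_ne_of_mem_side hy
  obtain ⟨p, hp⟩ := hD.exists_fixedPoint_s5
    ((hD.continuous_collapse_compl (z := y) (y := x)).comp
      ((hD.continuous_collapse_compl (z := x) (y := y)).comp hh))
  simp only [Function.comp_apply] at hp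
  by_cases h1 : h p ∈ side x y
  · rw [if_pos h1] at hp
    split_ifs at hp with h2
    · exact ⟨p, ⟨hp ▸ h1, hp ▸ h2⟩, hp⟩
    · exact absurd hy (hp ▸ h2)
  · rw [if_neg h1, if_pos (mem_side hxy)] at hp
    exact absurd hx (hp ▸ h1)

/-- If `h` moves `x` and `y` away from each other, the arc between them contains a fixed point. -/
theorem IsDendrite.exists_fixedPoint_arc (hD : IsDendrite X) {h : X → X} (hh : Continuous h)
    (hxy : x ≠ y) (hx : h x ∉ side x y) (hy : h y ∉ side y x) :
    ∃ s ∈ arc x y, h s = s := by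
  by_contra! hfix
  set F : Set X := {s | s ∈ arc x y ∧ s ≠ x ∧ h s ∉ side s x}
  have hF : IsClosed F := by
    refine isClosed_of_closure_subset fun s hs => ?_
    have hsarc : s ∈ arc x y :=
      closure_minimal (fun a (ha : a ∈ F) => ha.1) hD.isClosed_arc hs
    by_contra hsF
    obtain ⟨N, hN, hNF⟩ : ∃ N ∈ 𝓝 s, ∀ t ∈ N, t ∈ arc x y → t ≠ x → h t ∈ side t x := by
      rcases eq_or_ne s x with rfl | hsx
      · refine ⟨h ⁻¹' side s (h s), (hD.isOpen_side_s5.preimage hh).mem_nhds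
          (mem_side (hfix s hsarc)), fun t htN ht hts => ?_⟩
        refine isPreconnected_insert_side.mem_side ?_ (mem_insert _ _)
          (mem_insert_of_mem _ htN)
        rw [mem_insert_iff, not_or]
        refine ⟨hts, fun h' => hx ?_⟩
        rw [side_eq (mem_side_of_mem_arc ht hts), ← mem_side_comm]
        exact h'
      · have hhs : h s ∈ side s x := by
          by_contra h'
          exact hsF ⟨hsarc, hsx, h'⟩
        obtain ⟨q, hq, h1, h2⟩ := hD.exists_behind hhs
        refine ⟨side q s ∩ h ⁻¹' (insert q (side q s))ᶜ,
          inter_mem (hD.isOpen_side_s5.mem_nhds (mem_side hq.symm))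
            ((isClosed_insert_side.isOpen_compl.preimage hh).mem_nhds h2), ?_⟩
        rintro t ⟨ht, ht'⟩ - -
        exact mem_side_of_notMem_side (fun h' => h1 (mem_insert_of_mem _ h'))
          (fun h' => ht' (mem_insert_of_mem _ h')) ht
    obtain ⟨t, htN, ht1, ht2, ht3⟩ := mem_closure_iff_nhds.1 hs N hN
    exact ht3 (hNF t htN ht1 ht2)
  have hyF : y ∈ F := ⟨right_mem_arc, hxy.symm, hy⟩
  have : Nonempty F := ⟨⟨y, hyF⟩⟩
  have hcl : ∀ t : F, IsClosed (F ∩ arc x t) := fun t => hF.inter hD.isClosed_arc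
  obtain ⟨m, hm⟩ := IsCompact.nonempty_iInter_of_directed_nonempty_isCompact_isClosed
    (fun t : F => F ∩ arc x t)
    (by
      intro s t
      rcases arc_total s.2.1 t.2.1 with h' | h'
      · exact ⟨s, Subset.rfl, inter_subset_inter_right _ (arc_subset_arc h')⟩
      · exact ⟨t, inter_subset_inter_right _ (arc_subset_arc h'), Subset.rfl⟩)
    (fun t => ⟨t, t.2, right_mem_arc⟩) (fun t => (hcl t).isCompact) hcl
  have hmin : ∀ t ∈ F, m ∈ arc x t := fun t ht => (mem_iInter.1 hm ⟨t, ht⟩).2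
  obtain ⟨hmarc, hmx, hmh⟩ : m ∈ F := (mem_iInter.1 hm ⟨y, hyF⟩).1
  obtain ⟨t, ht, ⟨htN, htx⟩, htm⟩ := hD.exists_mem_arc_of_mem_nhds hmx
    (N := h ⁻¹' side m (h m) ∩ {x}ᶜ)
    (inter_mem ((hD.isOpen_side_s5.preimage hh).mem_nhds (mem_side (hfix m hmarc)))
      (isOpen_compl_singleton.mem_nhds hmx))
  have htarc : t ∈ arc x m := mem_arc_comm.1 ht
  have htm' : t ∉ side m (h m) := by
    intro h'
    refine hmh ?_
    rw [side_eq (mem_side_of_mem_arc ht htm), ← mem_side_comm]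
    exact h'
  have hht : h t ∈ side t m := by
    refine isPreconnected_insert_side.mem_side ?_ (mem_insert _ _) (mem_insert_of_mem _ htN)
    rw [mem_insert_iff, not_or]
    exact ⟨htm, htm'⟩
  have htF : t ∈ F := by
    refine ⟨arc_subset_arc hmarc htarc, htx, fun h' => htarc ?_⟩
    rw [side_eq h', ← mem_side_comm]
    exact hht
  exact htm (arc_antisymm htarc (hmin t htF))

/-- If `g` moves `x` to a point strictly between `x` and `w`, and there are no periodic points
there, then the orbit of `x` stays on the side of `w`. -/
theorem IsDendrite.iterate_mem_side (hD : IsDendrite X) {g : X → X} (hg : Continuous g) {w : X}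
    (hx : ¬ IsPeriodic g x) (hfree : ∀ a ∈ side x w ∩ side w x, ¬ IsPeriodic g a)
    (hz : g x ∈ side x w ∩ side w x) {k : ℕ} (hk : 1 ≤ k) : g^[k] x ∈ side x w := by
  obtain ⟨c, hcxw, hcxz, hcwz⟩ := hD.exists_median_s5 x w (g x)
  have hcx : c ≠ x := by
    rintro rfl
    rw [mem_arc_comm] at hcwz
    exact hcwz (mem_side_comm.1 hz.1)
  have hcw : c ≠ w := by
    rintro rfl
    exact hcxz hz.2
  have hcV : c ∈ side x w ∩ side w x :=
    ⟨mem_side_of_mem_arc hcxw hcx, mem_side_of_mem_arc (mem_arc_comm.1 hcxw) hcw⟩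
  have hxw : side x w = side x c := side_eq hcV.1
  have hxc : x ∉ side c (g x) := fun h => hcxz (mem_side_comm.1 h)
  have hwc : w ∉ side c (g x) := fun h => hcwz (mem_side_comm.1 h)
  have hgc : g c ∉ side c (g x) := by
    intro h
    obtain ⟨p, hp, hgp⟩ := hD.exists_fixedPoint_side hg h
    have hp' : p ∈ insert c (side c (g x)) := mem_insert_of_mem _ hp
    refine hfree p ⟨?_, ?_⟩ ⟨1, le_rfl, hgp⟩
    · exact isPreconnected_insert_side.subset_side
        (by rw [mem_insert_iff, not_or]; exact ⟨hcx.symm, hxc⟩) (mem_insert _ _) hcV.1 hp'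
    · exact isPreconnected_insert_side.subset_side
        (by rw [mem_insert_iff, not_or]; exact ⟨hcw.symm, hwc⟩) (mem_insert _ _) hcV.2 hp'
  obtain ⟨u, hu, hguc⟩ : c ∈ g '' arc x c := by
    by_contra h
    exact hgc ((hD.isPreconnected_arc.image g hg.continuousOn).mem_side h
      (mem_image_of_mem g left_mem_arc) (mem_image_of_mem g right_mem_arc))
  induction k, hk using Nat.le_induction with
  | base => exact hz.1
  | succ k hk ih =>
    by_contra hn
    have hkc : g^[k] c ∉ side c x := by
      intro h
      obtain ⟨p, hp, hgp⟩ := hD.exists_fixedPoint_between (hg.iterate k) (hxw ▸ ih) h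
      exact hfree p ⟨hxw ▸ hp.1, side_subset_side_of_mem_arc hcxw hp.2⟩ ⟨k, hk, hgp⟩
    have hku : g^[k + 1] u ∉ side c x := by
      rwa [Function.iterate_succ_apply, hguc]
    have hux : u ≠ x := by
      rintro rfl
      refine hn ?_
      rw [hxw]
      exact mem_side_of_notMem_side notMem_side_self hku (mem_side hcx.symm)
    have huw : side x w = side x u := by
      rw [hxw]
      exact side_eq (mem_side_of_mem_arc hu hux)
    obtain ⟨s, hs, hgs⟩ := hD.exists_fixedPoint_arc (hg.iterate (k + 1)) hux.symm (huw ▸ hn)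
      (fun h => hku (side_subset_side_of_mem_arc hu h))
    rcases eq_or_ne s x with rfl | hsx
    · exact hx ⟨k + 1, by omega, hgs⟩
    · have hsc : s ∈ arc x c := arc_subset_arc hu hs
      have hsw : s ≠ w := by
        rintro rfl
        exact hcw (arc_antisymm hcxw hsc)
      have hs' : s ∈ arc x w := arc_subset_arc hcxw hsc
      exact hfree s ⟨mem_side_of_mem_arc hs' hsx, mem_side_of_mem_arc (mem_arc_comm.1 hs') hsw⟩
        ⟨k + 1, by omega, hgs⟩

theorem IsDendrite.exists_between_subset (hD : IsDendrite X) (hyx : y ≠ x) {W : Set X}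
    (hW : IsOpen W) (hxW : x ∈ W) : ∃ w ∈ side x y, side x w ∩ side w x ⊆ W := by
  have : Nonempty (side x y) := ⟨⟨y, mem_side hyx⟩⟩
  have hmem : ∀ q r, r ≠ x → q ∈ side x y → q ∉ insert r (side r x) → r ∈ side x y := by
    intro q r hr hq hqr
    rw [side_eq hq]
    exact mem_side_of_notMem_side (fun h => hqr (mem_insert_of_mem _ h)) notMem_side_self
      (mem_side hr.symm)
  have hcomp : IsCompact (insert x (side x y) \ W) :=
    (isClosed_insert_side.sdiff hW).isCompact
  obtain ⟨⟨w, hw⟩, hsub⟩ := hcomp.elim_directed_cover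
    (fun q : side x y => (insert (q : X) (side (q : X) x))ᶜ)
    (fun q => isClosed_insert_side.isOpen_compl)
    (by
      rintro a ⟨rfl | ha, haW⟩
      · exact absurd hxW haW
      · have ha' : a ∈ side x a := mem_side (ne_of_mem_side ha)
        obtain ⟨q, hq, h, -⟩ := hD.exists_behind ha'
        exact mem_iUnion.2 ⟨⟨q, hmem a q hq ha h⟩, h⟩)
    (by
      rintro ⟨q, hq⟩ ⟨r, hr⟩
      obtain ⟨s, hs, h1, h2⟩ := hD.exists_behind (a := q) (b := r) (p := x) (side_eq hq ▸ hr)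
      exact ⟨⟨s, hmem q s hs hq h1⟩,
        fun _ => notMem_insert_side_of_mem_arc fun h => h1 (mem_insert_of_mem _ h),
        fun _ => notMem_insert_side_of_mem_arc fun h => h2 (mem_insert_of_mem _ h)⟩)
  refine ⟨w, hw, fun a ha => ?_⟩
  by_contra haW
  exact hsub ⟨mem_insert_of_mem _ (side_eq hw ▸ ha.1), haW⟩ (mem_insert_of_mem _ ha.2)

/-- A point with dense orbit that is no limit of periodic points returns to each of its sides
along all multiples of some time. -/
theorem IsDendrite.exists_iterate_mul_mem_side (hD : IsDendrite X) {f : X → X}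
    (hf : Continuous f) (hx : HasDenseOrbit f x) (hper : x ∉ closure {p | IsPeriodic f p})
    (hyx : y ≠ x) : ∃ n, 1 ≤ n ∧ ∀ k, 1 ≤ k → f^[n * k] x ∈ side x y := by
  obtain ⟨w, hw, hsub⟩ := hD.exists_between_subset hyx isClosed_closure.isOpen_compl hper
  have hwx : w ≠ x := ne_of_mem_side hw
  obtain ⟨a, haw, hax⟩ := mem_closure_iff_nhds.1 (mem_closure_side hwx) (side w x)
    (hD.isOpen_side_s5.mem_nhds (mem_side hwx.symm))
  obtain ⟨_, hb, n, hn, rfl⟩ := hx.inter_open_nonempty (side x w ∩ side w x)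
    (hD.isOpen_side_s5.inter hD.isOpen_side_s5) ⟨a, hax, haw⟩
  refine ⟨n, hn, fun k hk => ?_⟩
  rw [Function.iterate_mul, side_eq hw]
  exact hD.iterate_mem_side (hf.iterate n)
    (fun h => hper (subset_closure (h.of_iterate hn)))
    (fun a ha h => hsub ha (subset_closure (h.of_iterate hn))) hb hk

end Dendrite

/-- For a transitive dendrite map without dense periodic points, every
point with dense orbit is an endpoint. -/
theorem stmt5 {D : Type*} [MetricSpace D] [CompactSpace D] [ConnectedSpace D]
    (hD : IsDendrite D) {f : D → D} (hf : Continuous f) (htrans : TopTransitive f)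
    (hnd : ¬ Dense {p : D | IsPeriodic f p}) :
    ∀ x : D, HasDenseOrbit f x → IsEndpointOf D x := by
  intro x hx
  have hper : x ∉ closure {p | IsPeriodic f p} := by
    intro h
    have hmaps : MapsTo f {p | IsPeriodic f p} {p | IsPeriodic f p} := by
      rintro p ⟨n, hn, hp⟩
      exact ⟨n, hn, by rw [← Function.iterate_succ_apply, Function.iterate_succ_apply', hp]⟩
    refine hnd (Dense.of_closure (hx.mono ?_))
    rintro _ ⟨n, -, rfl⟩
    exact (hmaps.closure hf).iterate n h
  refine isPreconnected_of_forall_pair fun a ha b hb => ?_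
  obtain ⟨n, hn, hna⟩ := hD.exists_iterate_mul_mem_side hf hx hper ha
  obtain ⟨m, hm, hmb⟩ := hD.exists_iterate_mul_mem_side hf hx hper hb
  have h1 := hna m hm
  have h2 := hmb n hn
  rw [mul_comm] at h2
  refine ⟨side x a, connectedComponentIn_subset _ _, mem_side ha, ?_, isPreconnected_side⟩
  rw [side_eq h1, ← mem_side_comm]
  exact h2
end
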